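/- Let C > 0 be a real number, N ≥ 1 an integer, and n ≥ 1 an integer satisfying exp(−(π/2)√(2n/3)) ≤ C · √(2N+1)/(√(24n))^{2N}. Then −C · √(2N+1)/(√(24n))^{2N} < R_{2N}(n) < (C + (6√2/π^{3/2}) · sinh(π/6) · √(1 + 1/(4N+1))) · √(2N+1)/(√(24n))^{2N}. -/

import Mathlib

open Real Finset Filter Topology

noncomputable def c (m : ℕ) : ℝ :=
  ((-1 : ℝ) ^ m / (4 * Real.sqrt 6) ^ m) *
    ∑ k ∈ Finset.range ((m + 1) / 2 + 1),
      ((m + 1).choose k : ℝ) * ((m + 1 - k : ℕ) : ℝ) / ((m + 1 - 2 * k).factorial : ℝ) *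
        (π / 6) ^ ((m : ℤ) - 2 * k)

/-- The number of partitions of `n`, as a real number. -/
noncomputable def p (n : ℕ) : ℝ := (Fintype.card (Nat.Partition n) : ℝ)

/-- The remainder after `N` terms of the asymptotic expansion. -/
noncomputable def R (N n : ℕ) : ℝ :=
  4 * Real.sqrt 3 * (n : ℝ) * Real.exp (-(π * Real.sqrt (2 * n / 3))) * p n -
    ∑ m ∈ Finset.range N, c m / (n : ℝ) ^ ((m : ℝ) / 2)

open MeasureTheory

lemma HasSum.congr_fun' {α β : Type*} [AddCommMonoid α] [TopologicalSpace α] {f g : β → α} {a : α}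
    (hf : HasSum f a) (h : ∀ b, g b = f b) : HasSum g a := by
  rwa [funext h]

lemma integrable_add_sq_mul_exp {A a : ℝ} (hA : 0 < A) :
    Integrable fun t : ℝ ↦ (a ^ 2 + t ^ 2) * Real.exp (A * (a ^ 2 - t ^ 2)) := by
  have h1 := (integrable_exp_neg_mul_sq hA).const_mul (a ^ 2 * Real.exp (A * a ^ 2))
  have h2 := (integrable_rpow_mul_exp_neg_mul_sq hA (s := 2) (by norm_num)).const_mul
    (Real.exp (A * a ^ 2))
  refine (h1.add h2).congr (Eventually.of_forall fun t ↦ ?_)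
  have : Real.exp (A * (a ^ 2 - t ^ 2)) = Real.exp (A * a ^ 2) * Real.exp (-A * t ^ 2) := by
    rw [← Real.exp_add]; ring_nf
  simp only [Pi.add_apply, this, Real.rpow_ofNat]
  ring

lemma norm_line_sq (a t : ℝ) : ‖((a : ℂ) + t * Complex.I) ^ 2‖ = a ^ 2 + t ^ 2 := by
  rw [norm_pow, Complex.sq_norm, Complex.normSq_add_mul_I]

lemma re_line_sq (a t : ℝ) : (((a : ℂ) + t * Complex.I) ^ 2).re = a ^ 2 - t ^ 2 := by
  simp [sq]

lemma line_ne_zero {a : ℝ} (ha : 0 < a) (t : ℝ) : (a : ℂ) + t * Complex.I ≠ 0 := by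
  intro h
  have := congrArg Complex.re h
  simp at this
  exact ha.ne' this

lemma norm_cexp_line_sq (A a t : ℝ) :
    ‖Complex.exp (A * ((a : ℂ) + t * Complex.I) ^ 2)‖ = Real.exp (A * (a ^ 2 - t ^ 2)) := by
  rw [Complex.norm_exp, Complex.re_ofReal_mul, re_line_sq]

/-- The even power `s ^ (2 - 2 * k)` times the Gaussian `exp (A * s ^ 2)`, at `s = a + t * I`. -/
noncomputable def gaussPow (A a : ℝ) (k : ℕ) (t : ℝ) : ℂ :=
  ((a : ℂ) + t * Complex.I) ^ 2 * ((((a : ℂ) + t * Complex.I) ^ 2)⁻¹) ^ k *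
    Complex.exp (A * ((a : ℂ) + t * Complex.I) ^ 2)

lemma continuous_gaussPow {A a : ℝ} (ha : 0 < a) (k : ℕ) : Continuous (gaussPow A a k) := by
  have h : ∀ t : ℝ, ((a : ℂ) + t * Complex.I) ^ 2 ≠ 0 := fun t ↦ pow_ne_zero _ (line_ne_zero ha t)
  unfold gaussPow
  have h1 : Continuous fun t : ℝ ↦ ((a : ℂ) + t * Complex.I) ^ 2 := by fun_prop
  exact (h1.mul ((h1.inv₀ h).pow k)).mul (by fun_prop)

lemma norm_gaussPow_le {A a : ℝ} (ha : 0 < a) (k : ℕ) (t : ℝ) :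
    ‖gaussPow A a k t‖ ≤
      ((a ^ 2)⁻¹) ^ k * ((a ^ 2 + t ^ 2) * Real.exp (A * (a ^ 2 - t ^ 2))) := by
  unfold gaussPow
  rw [norm_mul, norm_mul, norm_pow _ k, norm_inv, norm_line_sq, norm_cexp_line_sq]
  have h1 : (a ^ 2 + t ^ 2)⁻¹ ≤ (a ^ 2)⁻¹ := by
    apply inv_anti₀ (by positivity); nlinarith
  have h2 : ((a ^ 2 + t ^ 2)⁻¹) ^ k ≤ ((a ^ 2)⁻¹) ^ k := by gcongr
  calc _ = ((a ^ 2 + t ^ 2)⁻¹) ^ k * ((a ^ 2 + t ^ 2) * Real.exp (A * (a ^ 2 - t ^ 2))) := by ring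
    _ ≤ _ := by gcongr


lemma integrable_gaussPow {A a : ℝ} (hA : 0 < A) (ha : 0 < a) (k : ℕ) :
    Integrable (gaussPow A a k) :=
  ((integrable_add_sq_mul_exp hA).const_mul (((a ^ 2)⁻¹) ^ k)).mono'
    (continuous_gaussPow ha k).aestronglyMeasurable
    (Eventually.of_forall fun t ↦ norm_gaussPow_le ha k t)

lemma integral_gaussPow_one {A a : ℝ} (hA : 0 < A) (ha : 0 < a) :
    ∫ t, gaussPow A a 1 t = (Real.sqrt (π / A) : ℂ) := by
  have h := GaussianFourier.integral_cexp_neg_mul_sq_add_real_mul_I (b := (A : ℂ))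
    (by simpa using hA) (-a)
  have e : ∀ t : ℝ, gaussPow A a 1 t =
      Complex.exp (-(A : ℂ) * (t + ((-a : ℝ) : ℂ) * Complex.I) ^ 2) := by
    intro t
    unfold gaussPow
    rw [pow_one, mul_inv_cancel₀ (pow_ne_zero _ (line_ne_zero ha t)), one_mul]
    congr 1
    push_cast
    linear_combination ((A : ℂ) * a ^ 2 + A * t ^ 2) * Complex.I_sq
  simp_rw [e, h]
  rw [Real.sqrt_eq_rpow, Complex.ofReal_cpow (by positivity)]
  push_cast
  rfl

lemma integral_gaussPow_succ {A a : ℝ} (hA : 0 < A) (ha : 0 < a) (k : ℕ) :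
    (1 - 2 * (k : ℂ)) * ∫ t, gaussPow A a (k + 1) t = - (2 * A * ∫ t, gaussPow A a k t) := by
  have hne : ∀ t : ℝ, ((a : ℂ) + t * Complex.I) ≠ 0 := line_ne_zero ha
  let f : ℝ → ℂ := fun t ↦ ((a : ℂ) + t * Complex.I) * ((((a : ℂ) + t * Complex.I) ^ 2)⁻¹) ^ k *
    Complex.exp (A * ((a : ℂ) + t * Complex.I) ^ 2)
  have hd : ∀ t, HasDerivAt f
      (Complex.I * ((1 - 2 * (k : ℂ)) * gaussPow A a (k + 1) t + 2 * A * gaussPow A a k t)) t := by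
    intro t
    have h0 : HasDerivAt (fun t : ℝ ↦ (a : ℂ) + t * Complex.I) Complex.I t := by
      simpa using ((Complex.ofRealCLM.hasDerivAt (x := t)).mul_const Complex.I).const_add (a : ℂ)
    have h1 := h0.fun_pow 2
    have h2 := (h1.fun_inv (pow_ne_zero 2 (hne t))).fun_pow k
    have h3 := (h1.const_mul (A : ℂ)).cexp
    refine ((h0.fun_mul h2).fun_mul h3).congr_deriv ?_
    unfold gaussPow
    have hs := hne t
    generalize (a : ℂ) + t * Complex.I = s at hs
    rcases k with _ | k
    · simp only [zero_add, pow_one, pow_zero, Nat.cast_zero]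
      field_simp
      ring
    · simp only [Nat.add_sub_cancel, pow_succ]
      push_cast
      field_simp
      ring
  have hf : Integrable f := by
    refine ((integrable_gaussPow hA ha k).norm.const_mul a⁻¹).mono' ?_
      (Eventually.of_forall fun t ↦ ?_)
    · have h1 : Continuous fun t : ℝ ↦ ((a : ℂ) + t * Complex.I) ^ 2 := by fun_prop
      exact (((by fun_prop : Continuous fun t : ℝ ↦ ((a : ℂ) + t * Complex.I)).mul
        ((h1.inv₀ fun t ↦ pow_ne_zero _ (hne t)).pow k)).mul (by fun_prop)).aestronglyMeasurable
    · simp only [f, gaussPow, norm_mul, sq]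
      have hp := norm_pos_iff.mpr (hne t)
      have : a ≤ ‖(a : ℂ) + t * Complex.I‖ := by
        simpa using (le_abs_self _).trans (Complex.abs_re_le_norm ((a : ℂ) + t * Complex.I))
      have : 1 ≤ a⁻¹ * ‖(a : ℂ) + t * Complex.I‖ := by
        rw [← div_eq_inv_mul, one_le_div ha]; exact this
      have h9 : 0 ≤ ‖(a : ℂ) + t * Complex.I‖ *
        ‖((((a : ℂ) + t * Complex.I) * ((a : ℂ) + t * Complex.I))⁻¹) ^ k‖ *
        ‖Complex.exp (A * (((a : ℂ) + t * Complex.I) * ((a : ℂ) + t * Complex.I)))‖ := by positivity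
      nlinarith
  have h1 := integrable_gaussPow hA ha k
  have h2 := integrable_gaussPow hA ha (k + 1)
  have h3 := integral_eq_zero_of_hasDerivAt_of_integrable hd
    (((h2.const_mul _).add (h1.const_mul _)).const_mul _) hf
  rw [integral_const_mul, integral_add (h2.const_mul _) (h1.const_mul _), integral_const_mul,
    integral_const_mul] at h3
  have := (mul_eq_zero.mp h3).resolve_left Complex.I_ne_zero
  linear_combination this

lemma integral_gaussPow {A a : ℝ} (hA : 0 < A) (ha : 0 < a) (B : ℝ) (k : ℕ) :
    (B : ℂ) ^ k / (k.factorial : ℂ) * ∫ t, gaussPow A a k t =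
      ((Real.sqrt (π / A) / (2 * A) *
          ((2 * k - 1) * (4 * A * B) ^ k / ((2 * k).factorial : ℝ)) : ℝ) : ℂ) := by
  have hA' : (A : ℂ) ≠ 0 := by exact_mod_cast hA.ne'
  have h1 := integral_gaussPow_one hA ha
  rcases k with _ | k
  · have h := integral_gaussPow_succ hA ha 0
    rw [zero_add, h1] at h
    have : ∫ t, gaussPow A a 0 t = - (Real.sqrt (π / A) : ℂ) / (2 * A) := by
      field_simp
      simp at h
      rw [h]; ring
    simp [this]
    field_simp
  · induction k with
    | zero =>
      simp [h1]
      field_simp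
      norm_num
    | succ k ih =>
      have h := integral_gaussPow_succ hA ha (k + 1)
      have hk : (1 - 2 * ((k + 1 : ℕ) : ℂ)) ≠ 0 := by
        intro h
        have h' : (1 : ℂ) = ((2 * (k + 1) : ℕ) : ℂ) := by
          push_cast at h ⊢
          linear_combination h
        have : 1 = 2 * (k + 1) := by exact_mod_cast h'
        omega
      have e : ∫ t, gaussPow A a (k + 1 + 1) t =
          2 * A / (2 * ((k + 1 : ℕ) : ℂ) - 1) * ∫ t, gaussPow A a (k + 1) t := by
        have hk' : 2 * ((k + 1 : ℕ) : ℂ) - 1 ≠ 0 := by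
          intro h; apply hk; linear_combination - h
        field_simp
        linear_combination - h
      have hk' : 2 * ((k : ℂ) + 1) - 1 ≠ 0 := by
        intro h; apply hk; push_cast; linear_combination - h
      rw [e]
      have f1 : ((k + 1 + 1).factorial : ℂ) = (k + 2) * (k + 1).factorial := by
        rw [Nat.factorial_succ (k + 1)]; push_cast; ring
      have f2 : ((2 * (k + 1 + 1)).factorial : ℂ) =
          (2 * (k + 2)) * (2 * k + 3) * (2 * (k + 1)).factorial := by
        rw [show 2 * (k + 1 + 1) = 2 * (k + 1) + 1 + 1 by ring, Nat.factorial_succ,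
          Nat.factorial_succ]; push_cast; ring
      calc _ = B / (k + 2) * (2 * A / (2 * (k + 1) - 1)) *
            (B ^ (k + 1) / ((k + 1).factorial : ℂ) * ∫ t, gaussPow A a (k + 1) t) := by
              rw [f1]
              have : ((k : ℂ) + 2) ≠ 0 := by exact_mod_cast (by omega : k + 2 ≠ 0)
              have : ((k + 1).factorial : ℂ) ≠ 0 := by exact_mod_cast (Nat.factorial_ne_zero _)
              push_cast
              field_simp
              ring
        _ = _ := by
              rw [ih]
              push_cast
              rw [f2]
              have : ((k : ℂ) + 2) ≠ 0 := by exact_mod_cast (by omega : k + 2 ≠ 0)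
              have : (2 * (k : ℂ) + 3) ≠ 0 := by exact_mod_cast (by omega : 2 * k + 3 ≠ 0)
              have hsub : 2 * ((k : ℂ) + 1 + 1) - 1 = 2 * k + 3 := by ring
              rw [hsub]
              have : ((2 * (k + 1)).factorial : ℂ) ≠ 0 := by
                exact_mod_cast (Nat.factorial_ne_zero _)
              generalize 2 * (k : ℂ) + 3 = w at *
              field_simp
              ring

lemma hasSum_sinh_sub_cosh (X : ℝ) :
    HasSum (fun k : ℕ ↦ (2 * (k : ℝ) - 1) * (X ^ 2) ^ k / ((2 * k).factorial : ℝ))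
      (X * Real.sinh X - Real.cosh X) := by
  have h1 := Real.hasSum_cosh X
  have h2 := (Real.hasSum_sinh X).mul_left X
  have h3 : HasSum (fun k : ℕ ↦ 2 * (k : ℝ) * (X ^ 2) ^ k / ((2 * k).factorial : ℝ))
      (X * Real.sinh X) := by
    rw [← hasSum_nat_add_iff' 1]
    simp only [range_one, sum_singleton, Nat.cast_zero, mul_zero, zero_mul, zero_div, sub_zero]
    refine h2.congr_fun' fun k ↦ ?_
    rw [show 2 * (k + 1) = 2 * k + 1 + 1 by ring, Nat.factorial_succ (2 * k + 1)]
    have : ((2 * k + 1).factorial : ℝ) ≠ 0 := by exact_mod_cast (Nat.factorial_ne_zero _)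
    push_cast
    field_simp
    ring
  refine (h3.sub h1).congr_fun' fun k ↦ ?_
  rw [pow_mul]; ring

/-- The Hankel-type integrand on the vertical line `s = a + t * I`. -/
noncomputable def hankelLine (A B a t : ℝ) : ℂ :=
  ((a : ℂ) + t * Complex.I) ^ 2 *
    Complex.exp (A * ((a : ℂ) + t * Complex.I) ^ 2 + B * (((a : ℂ) + t * Complex.I) ^ 2)⁻¹)

lemma hankelLine_hasSum (A B a t : ℝ) :
    HasSum (fun k : ℕ ↦ (B : ℂ) ^ k / (k.factorial : ℂ) * gaussPow A a k t)
      (hankelLine A B a t) := by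
  have h := NormedSpace.expSeries_div_hasSum_exp ((B : ℂ) * (((a : ℂ) + t * Complex.I) ^ 2)⁻¹)
  rw [← Complex.exp_eq_exp_ℂ] at h
  have := h.mul_left (((a : ℂ) + t * Complex.I) ^ 2 *
      Complex.exp (A * ((a : ℂ) + t * Complex.I) ^ 2))
  rw [hankelLine, Complex.exp_add, ← mul_assoc]
  refine this.congr_fun' fun k ↦ ?_
  unfold gaussPow
  rw [mul_pow]
  ring

lemma integral_hankelLine {A B a : ℝ} (hA : 0 < A) (hB : 0 ≤ B) (ha : 0 < a) :
    ∫ t, hankelLine A B a t = ((Real.sqrt (π / A) / (2 * A) *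
      (2 * Real.sqrt (A * B) * Real.sinh (2 * Real.sqrt (A * B)) -
          Real.cosh (2 * Real.sqrt (A * B))) : ℝ) : ℂ) := by
  have hi : ∀ k : ℕ, Integrable (fun t ↦ (B : ℂ) ^ k / (k.factorial : ℂ) * gaussPow A a k t) :=
    fun k ↦ (integrable_gaussPow hA ha k).const_mul _
  have hs : Summable fun k : ℕ ↦ ∫ t, ‖(B : ℂ) ^ k / (k.factorial : ℂ) * gaussPow A a k t‖ := by
    have hM := integrable_add_sq_mul_exp (a := a) hA
    refine Summable.of_nonneg_of_le (fun k ↦ integral_nonneg fun t ↦ norm_nonneg _) (fun k ↦ ?_)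
      ((Real.summable_pow_div_factorial (B * (a ^ 2)⁻¹)).mul_right
        (∫ t, (a ^ 2 + t ^ 2) * Real.exp (A * (a ^ 2 - t ^ 2))))
    rw [← integral_const_mul]
    refine integral_mono (hi k).norm (hM.const_mul _) fun t ↦ ?_
    simp only [norm_mul, norm_div, norm_pow, Complex.norm_real, Complex.norm_natCast,
      Real.norm_of_nonneg hB]
    calc _ ≤ B ^ k / (k.factorial : ℝ) *
        (((a ^ 2)⁻¹) ^ k * ((a ^ 2 + t ^ 2) * Real.exp (A * (a ^ 2 - t ^ 2)))) := by
          gcongr; exact norm_gaussPow_le ha k t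
      _ = _ := by rw [mul_pow]; ring
  have h := hasSum_integral_of_summable_integral_norm hi hs
  have e : ∀ t, ∑' k : ℕ, (B : ℂ) ^ k / (k.factorial : ℂ) * gaussPow A a k t = hankelLine A B a t :=
    fun t ↦ (hankelLine_hasSum A B a t).tsum_eq
  simp_rw [e, integral_const_mul, integral_gaussPow hA ha] at h
  refine h.unique ?_
  apply Complex.hasSum_ofReal.mpr
  apply HasSum.mul_left
  refine (hasSum_sinh_sub_cosh (2 * Real.sqrt (A * B))).congr_fun' fun k ↦ ?_
  have : (2 * Real.sqrt (A * B)) ^ 2 = 4 * A * B := by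
    rw [mul_pow, Real.sq_sqrt (by positivity)]; ring
  rw [this]

lemma continuous_hankelLine {A B a : ℝ} (ha : 0 < a) : Continuous (hankelLine A B a) := by
  have h1 : Continuous fun t : ℝ ↦ ((a : ℂ) + t * Complex.I) ^ 2 := by fun_prop
  have h2 := h1.inv₀ fun t ↦ pow_ne_zero 2 (line_ne_zero ha t)
  exact h1.mul (((continuous_const.mul h1).add (continuous_const.mul h2)).cexp)

lemma norm_hankelLine_le {A B a r t : ℝ} (hB : 0 ≤ B) (hr : 0 < r) (h : r ≤ a ^ 2 + t ^ 2) :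
    ‖hankelLine A B a t‖ ≤
      Real.exp (B / r) * ((a ^ 2 + t ^ 2) * Real.exp (A * (a ^ 2 - t ^ 2))) := by
  rw [hankelLine, norm_mul, norm_line_sq, Complex.norm_exp, Complex.add_re, Complex.re_ofReal_mul,
    Complex.re_ofReal_mul, re_line_sq, Real.exp_add]
  have h1 : ((((a : ℂ) + t * Complex.I) ^ 2)⁻¹).re ≤ 1 / r := by
    refine (Complex.re_le_norm _).trans ?_
    rw [norm_inv, norm_line_sq, one_div]
    exact inv_anti₀ hr h
  have h2 : Real.exp (B * ((((a : ℂ) + t * Complex.I) ^ 2)⁻¹).re) ≤ Real.exp (B / r) := by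
    rw [Real.exp_le_exp, div_eq_mul_one_div]
    gcongr
  have h3 : 0 ≤ a ^ 2 + t ^ 2 := by positivity
  calc _ ≤ (a ^ 2 + t ^ 2) * (Real.exp (A * (a ^ 2 - t ^ 2)) * Real.exp (B / r)) := by gcongr
    _ = _ := by ring

lemma integrable_hankelLine {A B a : ℝ} (hA : 0 < A) (hB : 0 ≤ B) (ha : 0 < a) :
    Integrable (hankelLine A B a) :=
  ((integrable_add_sq_mul_exp hA).const_mul (Real.exp (B / a ^ 2))).mono'
    (continuous_hankelLine ha).aestronglyMeasurable
    (Eventually.of_forall fun t ↦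
        norm_hankelLine_le hB (by positivity) (by nlinarith [sq_nonneg t]))

lemma csqrt_re_pos {z : ℂ} (hz : 0 < z.re) : 0 < (Complex.sqrt z).re := by
  rw [Complex.sqrt, Complex.cpow_inv_two_re]
  have := norm_nonneg z
  positivity

lemma csqrt_sq (z : ℂ) : (Complex.sqrt z) ^ 2 = z := by
  simp [Complex.sqrt]

lemma eq_csqrt_of_sq_eq {z w : ℂ} (h : w ^ 2 = z) (hw : 0 < w.re) (hz : 0 < z.re) :
    w = Complex.sqrt z := by
  rw [← csqrt_sq z] at h
  rcases sq_eq_sq_iff_eq_or_eq_neg.mp h with h | h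
  · exact h
  · have := csqrt_re_pos hz
    rw [h] at hw
    simp at hw
    linarith

lemma mem_ball_real_iff {c : ℝ} (hc : 0 < c) (s : ℂ) :
    s ∈ Metric.ball (c : ℂ) c ↔ ‖s‖ ^ 2 < 2 * c * s.re := by
  rw [Metric.mem_ball, Complex.dist_eq, ← abs_of_pos hc, ← abs_norm, ← sq_lt_sq, Complex.sq_norm,
    Complex.sq_norm, Complex.normSq_apply, Complex.normSq_apply, abs_of_pos hc]
  simp
  constructor <;> intro h <;> nlinarith

lemma integral_csqrt_eq_integral_hankelLine (A B : ℝ) {y h : ℝ} (hy : 0 < y) :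
    ∫ v in -h..h, Complex.sqrt (y + v * Complex.I) *
        Complex.exp (A * (y + v * Complex.I) + B * (y + v * Complex.I)⁻¹) =
      2 * ∫ t in -(Complex.sqrt (y + h * Complex.I)).im..(Complex.sqrt (y + h * Complex.I)).im,
        hankelLine A B (Complex.sqrt (y + h * Complex.I)).re t := by
  set s₀ := Complex.sqrt (y + h * Complex.I) with hs₀
  have hre : ∀ v : ℝ, 0 < ((y : ℂ) + v * Complex.I).re := fun v ↦ by simpa using hy
  have ha : 0 < s₀.re := csqrt_re_pos (hre h)
  set a := s₀.re
  set b := s₀.im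
  have hs0 : s₀ = a + b * Complex.I := (Complex.re_add_im s₀).symm
  have hs0' : Complex.sqrt (y + (-h : ℝ) * Complex.I) = a + (-b : ℝ) * Complex.I := by
    refine (eq_csqrt_of_sq_eq ?_ (by simpa using ha) (hre _)).symm
    have h1 : (a + b * Complex.I) ^ 2 = (y + h * Complex.I) := by
      rw [← hs0, csqrt_sq]
    have h2 := congrArg (starRingEnd ℂ) h1
    simp at h2
    push_cast
    linear_combination h2
  let S : ℝ → ℂ := fun v ↦ Complex.sqrt (y + v * Complex.I)
  have hSre : ∀ v, 0 < (S v).re := fun v ↦ csqrt_re_pos (hre v)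
  have hSne : ∀ v, S v ≠ 0 := fun v h0 ↦ by
    have := hSre v
    rw [h0] at this
    simp at this
  have hSd : ∀ v, HasDerivAt S (Complex.I / (2 * S v)) v := by
    intro v
    have h0 : HasDerivAt (fun v : ℝ ↦ (y : ℂ) + v * Complex.I) Complex.I v := by
      simpa using ((Complex.ofRealCLM.hasDerivAt (x := v)).mul_const Complex.I).const_add (y : ℂ)
    have h1 : HasDerivAt Complex.sqrt _ ((y : ℂ) + v * Complex.I) :=
      Complex.hasDerivAt_sqrt (Or.inl (hre v))
    refine (h1.comp v h0).congr_deriv ?_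
    have h2 : ((y : ℂ) + v * Complex.I) ^ (-1 / 2 : ℂ) = (S v)⁻¹ := by
      rw [neg_div, one_div, Complex.cpow_neg]; rfl
    rw [h2]
    have := hSne v
    field_simp
  have hSc : Continuous S := continuous_iff_continuousAt.mpr fun v ↦ (hSd v).continuousAt
  -- a ball containing both curves
  obtain ⟨c, hc0, hcb⟩ : ∃ c : ℝ, 0 < c ∧
      ((∀ v ∈ Set.uIcc (-h) h, S v ∈ Metric.ball (c : ℂ) c) ∧
        ∀ t ∈ Set.uIcc (-b) b, (a : ℂ) + t * Complex.I ∈ Metric.ball (c : ℂ) c) := by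
    have h1 : ContinuousOn (fun v ↦ ‖S v‖ ^ 2 / (S v).re) (Set.uIcc (-h) h) := by
      apply Continuous.continuousOn
      exact (hSc.norm.pow 2).div (Complex.continuous_re.comp hSc) fun v ↦ (hSre v).ne'
    have h2 : ContinuousOn (fun t : ℝ ↦ ‖(a : ℂ) + t * Complex.I‖ ^ 2 / a) (Set.uIcc (-b) b) := by
      fun_prop
    obtain ⟨M1, hM1⟩ := isCompact_uIcc.exists_bound_of_continuousOn h1
    obtain ⟨M2, hM2⟩ := isCompact_uIcc.exists_bound_of_continuousOn h2
    have hc : 0 < |M1| + |M2| + 1 := by positivity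
    refine ⟨|M1| + |M2| + 1, hc, fun v hv ↦ ?_, fun t ht ↦ ?_⟩
    · rw [mem_ball_real_iff hc]
      have h3 := (le_abs_self _).trans ((hM1 v hv).trans (le_abs_self M1))
      rw [div_le_iff₀ (hSre v)] at h3
      nlinarith [abs_nonneg M1, abs_nonneg M2, hSre v, mul_nonneg (abs_nonneg M1) (hSre v).le,
        mul_nonneg (abs_nonneg M2) (hSre v).le]
    · rw [mem_ball_real_iff hc]
      have h3 := (le_abs_self _).trans ((hM2 t ht).trans (le_abs_self M2))
      rw [div_le_iff₀ ha] at h3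
      simp only [Complex.add_re, Complex.ofReal_re, Complex.mul_re, Complex.I_re, mul_zero,
        Complex.ofReal_im, Complex.I_im, mul_one, sub_self, add_zero]
      nlinarith [abs_nonneg M1, abs_nonneg M2, mul_nonneg (abs_nonneg M1) ha.le,
        mul_nonneg (abs_nonneg M2) ha.le]
  let f : ℂ → ℂ := fun s ↦ 2 * s ^ 2 * Complex.exp (A * s ^ 2 + B * (s ^ 2)⁻¹)
  have hf : DifferentiableOn ℂ f (Metric.ball (c : ℂ) c) := by
    intro s hs
    have hs' : s ≠ 0 := by
      rintro rfl
      rw [mem_ball_real_iff hc0] at hs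
      simp at hs
    apply DifferentiableAt.differentiableWithinAt
    have : s ^ 2 ≠ 0 := pow_ne_zero 2 hs'
    fun_prop (disch := assumption)
  obtain ⟨G, hG⟩ := hf.isExactOn_ball
  have e1 := intervalIntegral.integral_eq_sub_of_hasDerivAt (a := -h) (b := h)
    (f := fun v ↦ G (S v))
    (f' := fun v ↦ Complex.I * (S v * Complex.exp (A * (S v) ^ 2 + B * ((S v) ^ 2)⁻¹)))
    (fun v hv ↦ by
      refine ((hG (S v) (hcb.1 v hv)).comp v (hSd v)).congr_deriv ?_
      have := hSne v
      simp only [f]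
      field_simp)
    (by
      apply Continuous.intervalIntegrable
      have := (hSc.pow 2).inv₀ (fun v ↦ pow_ne_zero 2 (hSne v))
      exact continuous_const.mul (hSc.mul (((continuous_const.mul (hSc.pow 2)).add
        (continuous_const.mul this)).cexp)))
  have e2 := intervalIntegral.integral_eq_sub_of_hasDerivAt (a := -b) (b := b)
    (f := fun t : ℝ ↦ G ((a : ℂ) + t * Complex.I))
    (f' := fun t ↦ Complex.I * (2 * hankelLine A B a t))
    (fun t ht ↦ by
      have h0 : HasDerivAt (fun t : ℝ ↦ (a : ℂ) + t * Complex.I) Complex.I t := by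
        simpa using ((Complex.ofRealCLM.hasDerivAt (x := t)).mul_const Complex.I).const_add (a : ℂ)
      refine ((hG _ (hcb.2 t ht)).comp t h0).congr_deriv ?_
      simp only [f, hankelLine]
      ring)
    (by
      apply Continuous.intervalIntegrable
      exact continuous_const.mul (continuous_const.mul (continuous_hankelLine ha)))
  have hSh : S h = a + b * Complex.I := hs0
  have hSh' : S (-h) = a + (-b : ℝ) * Complex.I := hs0'
  simp only [hSh, hSh'] at e1
  have e3 := e1.trans e2.symm
  rw [intervalIntegral.integral_const_mul, intervalIntegral.integral_const_mul,
    intervalIntegral.integral_const_mul] at e3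
  have e4 := mul_left_cancel₀ Complex.I_ne_zero e3
  rw [← e4]
  refine intervalIntegral.integral_congr fun v _ ↦ ?_
  simp only [S, csqrt_sq]

lemma integral_csqrt_approx {A B y : ℝ} (hA : 2 ≤ A) (hB : 0 ≤ B) (hB' : B ≤ π / 12) (hy : 0 < y)
    (hy' : y ≤ 1 / 100) :
    ‖(∫ v in (-(1 / 4) : ℝ)..(1 / 4), Complex.sqrt (y + v * Complex.I) *
        Complex.exp (A * (y + v * Complex.I) + B * (y + v * Complex.I)⁻¹)) -
      ((Real.sqrt (π / A) / A * (2 * Real.sqrt (A * B) * Real.sinh (2 * Real.sqrt (A * B)) -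
        Real.cosh (2 * Real.sqrt (A * B))) : ℝ) : ℂ)‖ ≤ 15 * Real.exp (A * y) := by
  have hA0 : 0 < A := by linarith
  rw [integral_csqrt_eq_integral_hankelLine A B hy]
  set s₀ := Complex.sqrt (y + (1 / 4 : ℝ) * Complex.I) with hs₀
  have hre : 0 < ((y : ℂ) + (1 / 4 : ℝ) * Complex.I).re := by simpa using hy
  have ha : 0 < s₀.re := csqrt_re_pos hre
  have hs := csqrt_sq (y + (1 / 4 : ℝ) * Complex.I)
  rw [← hs₀] at hs
  have hn : ‖s₀‖ ^ 2 = ‖(y : ℂ) + (1 / 4 : ℝ) * Complex.I‖ := by rw [← hs, norm_pow]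
  have hn1 : ‖(y : ℂ) + (1 / 4 : ℝ) * Complex.I‖ ^ 2 = y ^ 2 + 1 / 16 := by
    rw [Complex.sq_norm, Complex.normSq_add_mul_I]; norm_num
  have hre2 := congrArg Complex.re hs
  have him2 := congrArg Complex.im hs
  simp [sq] at hre2 him2
  rw [Complex.sq_norm, Complex.normSq_apply] at hn
  set a := s₀.re
  set b := s₀.im
  set r := ‖(y : ℂ) + (1 / 4 : ℝ) * Complex.I‖ with hr
  have hr0 : 0 ≤ r := norm_nonneg _
  have hr1 : 1 / 4 ≤ r := by nlinarith
  have hr2 : r ≤ y + 1 / 4 := by nlinarith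
  have hb : 0 < b := by
    by_contra hb
    nlinarith
  have hInt := integral_hankelLine hA0 hB ha
  have hI := integrable_hankelLine hA0 hB ha
  have e1 : (((Real.sqrt (π / A) / A * (2 * Real.sqrt (A * B) * Real.sinh (2 * Real.sqrt (A * B)) -
        Real.cosh (2 * Real.sqrt (A * B))) : ℝ) : ℂ)) = 2 * ∫ t, hankelLine A B a t := by
    rw [hInt]; push_cast; field_simp
  rw [e1, ← mul_sub, norm_mul]
  have e2 : (∫ t in -b..b, hankelLine A B a t) - ∫ t, hankelLine A B a t =
      - ∫ t in (Set.Ioc (-b) b)ᶜ, hankelLine A B a t := by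
    rw [intervalIntegral.integral_of_le (by linarith),
      ← integral_add_compl (measurableSet_Ioc (a := -b) (b := b)) hI]
    ring
  rw [e2, norm_neg]
  have hg : Integrable fun t : ℝ ↦ Real.exp (-1 * t ^ 2) := integrable_exp_neg_mul_sq one_pos
  let K : ℝ := Real.exp (π / 3) * (1.26 * Real.exp (A * y) * Real.exp (b ^ 2))
  have hK : 0 ≤ K := by positivity
  have e3 : ‖∫ t in (Set.Ioc (-b) b)ᶜ, hankelLine A B a t‖ ≤
      ∫ t in (Set.Ioc (-b) b)ᶜ, K * Real.exp (-1 * t ^ 2) := by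
    refine norm_integral_le_of_norm_le (hg.const_mul K).integrableOn ?_
    filter_upwards [ae_restrict_mem measurableSet_Ioc.compl] with t ht
    have htb : b ^ 2 ≤ t ^ 2 := by
      rw [Set.mem_compl_iff, Set.mem_Ioc, not_and_or, not_lt, not_le] at ht
      rcases ht with ht | ht <;> nlinarith
    refine (norm_hankelLine_le (r := 1 / 4) hB (by norm_num) (by nlinarith)).trans ?_
    have h1 : Real.exp (B / (1 / 4)) ≤ Real.exp (π / 3) := by
      rw [Real.exp_le_exp]; linarith
    have h2 : (a ^ 2 + t ^ 2) * Real.exp (A * (a ^ 2 - t ^ 2)) ≤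
        1.26 * Real.exp (A * y) * Real.exp (b ^ 2) * Real.exp (-1 * t ^ 2) := by
      rw [mul_assoc, ← Real.exp_add, mul_assoc, ← Real.exp_add]
      have h3 : A * (a ^ 2 - t ^ 2) = A * y - A * (t ^ 2 - b ^ 2) := by
        rw [sq a, sq b]; linear_combination A * hre2
      have h4 : 0 ≤ t ^ 2 - b ^ 2 := by linarith
      have h5 : Real.exp (A * (a ^ 2 - t ^ 2)) ≤
          Real.exp (-(t ^ 2 - b ^ 2)) * Real.exp (A * y + b ^ 2 + -1 * t ^ 2) := by
        rw [← Real.exp_add, Real.exp_le_exp, h3]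
        nlinarith
      have h6 : (a ^ 2 + t ^ 2) * Real.exp (-(t ^ 2 - b ^ 2)) ≤ 1.26 := by
        have h7 := Real.add_one_le_exp (t ^ 2 - b ^ 2)
        rw [Real.exp_neg, ← div_eq_mul_inv, div_le_iff₀ (Real.exp_pos _)]
        nlinarith
      calc _ ≤ (a ^ 2 + t ^ 2) *
          (Real.exp (-(t ^ 2 - b ^ 2)) * Real.exp (A * y + b ^ 2 + -1 * t ^ 2)) := by
            gcongr
        _ = ((a ^ 2 + t ^ 2) * Real.exp (-(t ^ 2 - b ^ 2))) *
            Real.exp (A * y + b ^ 2 + -1 * t ^ 2) := by ring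
        _ ≤ 1.26 * Real.exp (A * y + b ^ 2 + -1 * t ^ 2) := by gcongr
        _ = _ := by ring_nf
    calc _ ≤ Real.exp (π / 3) *
        (1.26 * Real.exp (A * y) * Real.exp (b ^ 2) * Real.exp (-1 * t ^ 2)) := by
          gcongr
      _ = _ := by simp only [K]; ring
  have e4 : ∫ t in (Set.Ioc (-b) b)ᶜ, K * Real.exp (-1 * t ^ 2) ≤ K * Real.sqrt π := by
    have h := integral_gaussian 1
    rw [div_one] at h
    rw [← h, ← integral_const_mul]
    exact setIntegral_le_integral (hg.const_mul K) (Eventually.of_forall fun t ↦ by positivity)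
  have e5 : K * Real.sqrt π ≤ 7.5 * Real.exp (A * y) := by
    have hpi := Real.pi_lt_d4
    have h1 : Real.exp (π / 3) ≤ 2.87 := by
      have : π / 3 ≤ 1 + 0.0473 := by linarith
      calc _ ≤ Real.exp (1 + 0.0473) := Real.exp_le_exp.mpr this
        _ = Real.exp 1 * Real.exp 0.0473 := Real.exp_add _ _
        _ ≤ 2.7182818286 * (1 / (1 - 0.0473)) := by
          gcongr
          · exact Real.exp_one_lt_d9.le
          · exact Real.exp_bound_div_one_sub_of_interval (by norm_num) (by norm_num)
        _ ≤ 2.87 := by norm_num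
    have h2 : Real.exp (b ^ 2) ≤ 8 / 7 := by
      have : b ^ 2 ≤ 1 / 8 := by nlinarith
      calc _ ≤ Real.exp (1 / 8) := Real.exp_le_exp.mpr this
        _ ≤ 1 / (1 - 1 / 8) := Real.exp_bound_div_one_sub_of_interval (by norm_num) (by norm_num)
        _ ≤ _ := by norm_num
    have h3 : Real.sqrt π ≤ 1.7726 := by
      rw [Real.sqrt_le_left (by norm_num)]; linarith
    calc _ ≤ 2.87 * (1.26 * Real.exp (A * y) * (8 / 7)) * 1.7726 := by
          simp only [K]; gcongr
      _ ≤ _ := by nlinarith [Real.exp_pos (A * y)]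
  rw [Complex.norm_two]
  linarith

lemma norm_tprod_one_sub_pow_sub_one_le {q : ℂ} (hq : ‖q‖ < 1) :
    ‖∏' n : ℕ, (1 - q ^ (n + 1)) - 1‖ ≤ Real.exp (‖q‖ / (1 - ‖q‖)) - 1 := by
  have h := (ModularForm.multipliable_one_sub_pow hq).hasProd
  refine le_of_tendsto ((h.sub_const 1).norm) (Eventually.of_forall fun t ↦ ?_)
  have h1 := t.norm_prod_one_add_sub_one_le (fun n : ℕ ↦ -q ^ (n + 1))
  simp only [← sub_eq_add_neg, norm_neg, norm_pow] at h1
  refine h1.trans ?_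
  gcongr
  have hg := (hasSum_geometric_of_lt_one (norm_nonneg q) hq).mul_left ‖q‖
  have : ∑ n ∈ t, ‖q‖ ^ (n + 1) ≤ ‖q‖ * (1 - ‖q‖)⁻¹ :=
    sum_le_hasSum t (fun n _ ↦ by positivity) (hg.congr_fun' fun n ↦ by rw [pow_succ'])
  rwa [div_eq_mul_inv]

lemma eta_eq_exp_mul_tprod (z : ℂ) : ModularForm.eta z =
    Complex.exp (2 * π * Complex.I * z / 24) *
      ∏' n : ℕ, (1 - Complex.exp (2 * π * Complex.I * z) ^ (n + 1)) := by
  simp only [ModularForm.eta, ModularForm.eta_q_eq_pow, Function.Periodic.qParam]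
  push_cast
  rfl

lemma norm_exp_two_pi_I_mul (z : ℂ) (r : ℝ) :
    ‖Complex.exp (2 * π * Complex.I * z * r)‖ = Real.exp (-(2 * π * z.im * r)) := by
  rw [Complex.norm_exp]
  congr 1
  simp

lemma eta_inv_approx {z : ℂ} (hz : 0.86 ≤ z.im) :
    ‖(ModularForm.eta z)⁻¹ - Complex.exp (-(2 * π * Complex.I * z / 24))‖ ≤ 0.03 ∧
      ‖(ModularForm.eta z)⁻¹‖ ≤ 1.03 * Real.exp (π * z.im / 12) := by
  set q := Complex.exp (2 * π * Complex.I * z) with hqdef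
  have hpi := Real.pi_gt_d2
  have hqn : ‖q‖ = Real.exp (-(2 * π * z.im)) := by
    have := norm_exp_two_pi_I_mul z 1
    simpa using this
  have he5 : Real.exp (-5) ≤ 0.007 := by
    have h1 := Real.exp_one_gt_d9
    rw [Real.exp_neg, show (5 : ℝ) = (5 : ℕ) * 1 by norm_num, Real.exp_nat_mul]
    rw [inv_le_comm₀ (by positivity) (by norm_num)]
    calc (0.007 : ℝ)⁻¹ ≤ 2.718 ^ 5 := by norm_num
      _ ≤ _ := by gcongr; linarith
  have hr : ‖q‖ ≤ 0.007 := by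
    rw [hqn]
    refine (Real.exp_le_exp.mpr ?_).trans he5
    nlinarith
  have hr0 : 0 ≤ ‖q‖ := norm_nonneg q
  set P := ∏' n : ℕ, (1 - q ^ (n + 1)) with hP
  have hP1 : ‖P - 1‖ ≤ 1.02 * ‖q‖ := by
    refine (norm_tprod_one_sub_pow_sub_one_le (by linarith)).trans ?_
    have h1 : ‖q‖ / (1 - ‖q‖) ≤ 1.008 * ‖q‖ := by
      rw [div_le_iff₀ (by linarith)]; nlinarith
    have h2 : Real.exp (1.008 * ‖q‖) ≤ 1 / (1 - 1.008 * ‖q‖) :=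
      Real.exp_bound_div_one_sub_of_interval (by positivity) (by linarith)
    have h3 : 1 / (1 - 1.008 * ‖q‖) ≤ 1 + 1.02 * ‖q‖ := by
      rw [div_le_iff₀ (by linarith)]; nlinarith
    linarith [Real.exp_le_exp.mpr h1]
  have hP2 : 0.99 ≤ ‖P‖ := by
    have := norm_sub_norm_le 1 P
    rw [norm_one, norm_sub_rev] at this
    linarith
  have hP0 : P ≠ 0 := norm_pos_iff.mp (by linarith)
  have hPi : ‖P⁻¹ - 1‖ ≤ 1.04 * ‖q‖ := by
    have : P⁻¹ - 1 = -(P - 1) * P⁻¹ := by field_simp; ring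
    rw [this, norm_mul, norm_neg, norm_inv, ← div_eq_mul_inv, div_le_iff₀ (by linarith)]
    nlinarith
  have hE : ‖Complex.exp (-(2 * π * Complex.I * z / 24))‖ = Real.exp (π * z.im / 12) := by
    have := norm_exp_two_pi_I_mul z (-(1 / 24))
    rw [show -(2 * π * z.im * (-(1 / 24))) = π * z.im / 12 by ring] at this
    rw [← this]
    push_cast
    ring_nf
  have heta : (ModularForm.eta z)⁻¹ = Complex.exp (-(2 * π * Complex.I * z / 24)) * P⁻¹ := by
    rw [eta_eq_exp_mul_tprod, mul_inv, Complex.exp_neg]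
  constructor
  · rw [heta, ← mul_sub_one, norm_mul, hE]
    have : Real.exp (π * z.im / 12) * ‖q‖ ≤ 0.007 := by
      rw [hqn, ← Real.exp_add]
      refine (Real.exp_le_exp.mpr ?_).trans he5
      nlinarith
    have h3 := mul_le_mul_of_nonneg_left hPi (Real.exp_pos (π * z.im / 12)).le
    linarith
  · rw [heta, norm_mul, hE, mul_comm]
    gcongr
    have := norm_sub_norm_le P⁻¹ 1
    rw [norm_one] at this
    linarith

open MatrixGroups in
lemma eta_norm_smul (g : SL(2, ℤ)) (τ : UpperHalfPlane) :
    ‖ModularForm.eta (g • τ : UpperHalfPlane)‖ ^ 4 * (g • τ).im =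
      ‖ModularForm.eta τ‖ ^ 4 * τ.im := by
  have h2 : SlashAction.map (12 : ℤ) g ModularForm.discriminant = ModularForm.discriminant :=
    SlashInvariantForm.slash_action_generators_SL2Z ModularForm.discriminant_S_invariant
      ModularForm.discriminant_T_invariant g
  have h3 := congrFun h2 τ
  rw [ModularForm.SL_slash_apply] at h3
  have hd := UpperHalfPlane.denom_ne_zero g τ
  have hz : UpperHalfPlane.denom g τ ^ (-12 : ℤ) = (UpperHalfPlane.denom g τ ^ 12)⁻¹ := by
    rw [zpow_neg]; rfl
  rw [hz, mul_inv_eq_iff_eq_mul₀ (pow_ne_zero _ hd)] at h3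
  have h4 : ‖ModularForm.eta (g • τ : UpperHalfPlane)‖ ^ 24 =
      ‖ModularForm.eta τ‖ ^ 24 * ‖UpperHalfPlane.denom g τ‖ ^ 12 := by
    have := congrArg norm h3
    rwa [norm_mul, norm_pow, ModularForm.discriminant, ModularForm.discriminant, norm_pow,
      norm_pow] at this
  have h5 : (g • τ).im = τ.im / ‖UpperHalfPlane.denom g τ‖ ^ 2 := by
    rw [ModularGroup.im_smul_eq_div_normSq, Complex.normSq_eq_norm_sq]
  have hd' : ‖UpperHalfPlane.denom g τ‖ ≠ 0 := norm_ne_zero_iff.mpr hd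
  have hi : 0 < τ.im := τ.im_pos
  refine (pow_left_inj₀ (by have := (g • τ).im_pos; positivity) (by positivity)
    (by norm_num : (6 : ℕ) ≠ 0)).mp ?_
  rw [mul_pow, mul_pow, ← pow_mul, ← pow_mul, h5]
  norm_num only
  rw [h4]
  field_simp

open MatrixGroups in
lemma exists_smul_im_ge (τ : UpperHalfPlane) : ∃ g : SL(2, ℤ), 0.86 ≤ (g • τ).im := by
  obtain ⟨g, hg⟩ := ModularGroup.exists_smul_mem_fd τ
  refine ⟨g, ?_⟩
  have := ModularGroup.three_le_four_mul_im_sq_of_mem_fd hg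
  have := (g • τ).im_pos
  nlinarith

/-- A lower bound for `|η|` when no cusp of denominator at most `2` is near. -/
lemma norm_eta_inv_le {τ : UpperHalfPlane} (hy : τ.im ≤ 1 / 327)
    (h : ∀ c d : ℤ, IsCoprime c d → c ^ 2 ≤ 4 → τ.im < 0.86 * Complex.normSq (c * τ + d)) :
    ‖(ModularForm.eta τ)⁻¹‖ ≤ 0.26 * Real.exp (π / (108 * τ.im)) := by
  obtain ⟨g, hg⟩ := exists_smul_im_ge τ
  have hi : 0 < τ.im := τ.im_pos
  have h1 : (g • τ).im = τ.im / Complex.normSq (g 1 0 * τ + g 1 1) := by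
    rw [ModularGroup.im_smul_eq_div_normSq, ModularGroup.denom_apply]
  have hN : 0 < Complex.normSq ((g 1 0 : ℂ) * τ + g 1 1) := by
    have := (g • τ).im_pos
    rw [h1] at this
    exact (div_pos_iff_of_pos_left hi).mp this
  have hc : 9 ≤ (g 1 0) ^ 2 := by
    by_contra hlt
    have h4 : (g 1 0) ^ 2 ≤ 4 := by
      by_contra h5
      have : |g 1 0| < 3 := by
        rw [← abs_of_nonneg (by norm_num : (0 : ℤ) ≤ 3)]; apply sq_lt_sq.mp; omega
      have : 2 < |g 1 0| := by
        rw [← abs_of_nonneg (by norm_num : (0 : ℤ) ≤ 2)]; apply sq_lt_sq.mp; omega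
      omega
    have h6 := h _ _ (Matrix.SpecialLinearGroup.isCoprime_row g 1) h4
    rw [h1, le_div_iff₀ hN] at hg
    linarith
  have hY : (g • τ).im ≤ 1 / (9 * τ.im) := by
    rw [h1, div_le_div_iff₀ hN (by positivity), Complex.normSq_apply]
    have : ((g 1 0 : ℂ) * τ + g 1 1).im = g 1 0 * τ.im := by simp
    rw [this]
    have : (9 : ℝ) ≤ (g 1 0 : ℝ) ^ 2 := by exact_mod_cast hc
    nlinarith [mul_self_nonneg ((g 1 0 : ℂ) * τ + g 1 1).re, mul_nonneg hi.le hi.le]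
  have h2 := (eta_inv_approx (z := (g • τ : UpperHalfPlane)) hg).2
  have h3 : ‖(ModularForm.eta (g • τ : UpperHalfPlane))⁻¹‖ ≤
      1.03 * Real.exp (π / (108 * τ.im)) := by
    refine h2.trans (mul_le_mul_of_nonneg_left (Real.exp_le_exp.mpr ?_) (by norm_num))
    have : π * (1 / (9 * τ.im)) / 12 = π / (108 * τ.im) := by field_simp; norm_num
    rw [← this]
    gcongr
    exact hY
  have h4 := eta_norm_smul g τ
  rw [norm_inv] at h3 ⊢
  set a := ‖ModularForm.eta (g • τ : UpperHalfPlane)‖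
  have ha : 0 < a := norm_pos_iff.mpr (ModularForm.eta_ne_zero (g • τ).2)
  have hb : 0 < ‖ModularForm.eta τ‖ := norm_pos_iff.mpr (ModularForm.eta_ne_zero τ.2)
  set b := ‖ModularForm.eta τ‖
  have h5 : (4 * a) ^ 4 ≤ b ^ 4 := by
    have : 0 ≤ a ^ 4 := by positivity
    by_contra hlt
    push Not at hlt
    have : b ^ 4 * τ.im < (4 * a) ^ 4 * τ.im := by gcongr
    have : a ^ 4 * 0.86 ≤ a ^ 4 * (g • τ).im := by gcongr
    nlinarith
  have h6 : 4 * a ≤ b := (pow_le_pow_iff_left₀ (by positivity) hb.le (by norm_num)).mp h5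
  calc b⁻¹ ≤ (4 * a)⁻¹ := by gcongr
    _ = a⁻¹ / 4 := by rw [mul_inv]; ring
    _ ≤ _ := by linarith [Real.exp_pos (π / (108 * τ.im))]

lemma csqrt_mem_quadrant {z : ℂ} (hz : 0 < z.im) :
    0 < (Complex.sqrt z).re ∧ 0 < (Complex.sqrt z).im := by
  have h1 : 0 < (Complex.sqrt z).re := by
    rw [Complex.sqrt, Complex.cpow_inv_two_re]
    have h2 : |z.re| < ‖z‖ := by
      rw [Complex.norm_eq_sqrt_sq_add_sq]
      apply Real.lt_sqrt_of_sq_lt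
      rw [sq_abs]
      nlinarith
    have := neg_abs_le z.re
    apply Real.sqrt_pos.mpr
    linarith
  refine ⟨h1, ?_⟩
  have h2 := congrArg Complex.im (csqrt_sq z)
  simp [sq] at h2
  by_contra h
  push Not at h
  nlinarith

lemma csqrt_div_csqrt_I {z : ℂ} (hz : 0 < z.im) :
    (Complex.sqrt Complex.I)⁻¹ * Complex.sqrt z = Complex.sqrt (-Complex.I * z) := by
  apply eq_csqrt_of_sq_eq
  · rw [mul_pow, inv_pow, csqrt_sq, csqrt_sq, Complex.inv_I]
  · obtain ⟨h1, h2⟩ := csqrt_mem_quadrant hz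
    obtain ⟨h3, h4⟩ := csqrt_mem_quadrant (z := Complex.I) (by simp)
    have h5 : 0 < Complex.normSq (Complex.sqrt Complex.I) := by
      rw [Complex.normSq_apply]; positivity
    rw [Complex.mul_re, Complex.inv_re, Complex.inv_im]
    have : 0 < ((Complex.sqrt Complex.I).re * (Complex.sqrt z).re +
      (Complex.sqrt Complex.I).im *
          (Complex.sqrt z).im) / Complex.normSq (Complex.sqrt Complex.I) := by
      positivity
    convert! this using 1
    ring
  · simpa using hz

lemma norm_csqrt_sq (z : ℂ) : ‖Complex.sqrt z‖ ^ 2 = ‖z‖ := by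
  rw [← norm_pow, csqrt_sq]

lemma norm_csqrt_I : ‖Complex.sqrt Complex.I‖ = 1 := by
  have := norm_csqrt_sq Complex.I
  rw [Complex.norm_I] at this
  nlinarith [norm_nonneg (Complex.sqrt Complex.I)]

lemma eta_neg_one_div {z : ℂ} (hz : 0 < z.im) :
    ModularForm.eta (-1 / z) = Complex.sqrt (-Complex.I * z) * ModularForm.eta z := by
  have h := ModularForm.eta_comp_eq_csqrt_I_inv (x := z) hz
  rw [← csqrt_div_csqrt_I hz, mul_assoc]
  exact h

lemma neg_one_div_im_pos {z : ℂ} (hz : 0 < z.im) : 0 < (-1 / z).im := by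
  have : z ≠ 0 := by rintro rfl; simp at hz
  have := Complex.normSq_pos.mpr this
  have h : (-1 / z).im = z.im / Complex.normSq z := by
    rw [Complex.div_im]
    simp
    ring
  rw [h]
  positivity

lemma eta_add_one (z : ℂ) :
    ModularForm.eta (z + 1) = Complex.exp (π * Complex.I / 12) * ModularForm.eta z := by
  rw [eta_eq_exp_mul_tprod, eta_eq_exp_mul_tprod]
  have h1 : Complex.exp (2 * π * Complex.I * (z + 1)) = Complex.exp (2 * π * Complex.I * z) := by
    rw [mul_add, mul_one, Complex.exp_add, Complex.exp_two_pi_mul_I, mul_one]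
  rw [h1, ← mul_assoc, ← Complex.exp_add]
  ring_nf

lemma csqrt_two_mul {z : ℂ} (hz : 0 < z.re) :
    Complex.sqrt (2 * z) = (Real.sqrt 2 : ℂ) * Complex.sqrt z := by
  symm
  apply eq_csqrt_of_sq_eq
  · rw [mul_pow, csqrt_sq]
    norm_cast
    rw [Real.sq_sqrt (by norm_num)]
    norm_num
  · rw [Complex.re_ofReal_mul]
    have := csqrt_re_pos hz
    positivity
  · simpa using hz

/-- Transformation of `η` under the modular substitution sending `1 / 2` to `∞`. -/
lemma exists_eta_transform_half : ∃ κ : ℂ, ‖κ‖ = 1 ∧ ∀ z : ℂ, 0 < z.im →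
    ModularForm.eta (-1 / (-1 / z + 1 + 1)) =
      κ * ((Real.sqrt 2 : ℂ) * Complex.sqrt (-Complex.I * (z - 1 / 2))) * ModularForm.eta z := by
  refine ⟨(Complex.sqrt Complex.I)⁻¹ *
    Complex.exp (π * Complex.I / 12) ^ 2, ?_, fun z hz ↦ ?_⟩
  · rw [norm_mul, norm_inv, norm_csqrt_I, norm_pow, Complex.norm_exp]
    simp
  · have hw0 := neg_one_div_im_pos hz
    have hz0 : z ≠ 0 := by rintro rfl; simp at hz
    have hw : 0 < (-1 / z + 1 + 1).im := by simpa using hw0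
    have hz2 : 0 < (2 * (z - 1 / 2)).im := by simp [hz]
    rw [eta_neg_one_div hw, eta_add_one, eta_add_one, eta_neg_one_div hz,
      ← csqrt_two_mul (by simpa using hz), ← csqrt_div_csqrt_I hw, ← csqrt_div_csqrt_I hz,
      show 2 * (-Complex.I * (z - 1 / 2)) = -Complex.I * (2 * (z - 1 / 2)) by ring,
      ← csqrt_div_csqrt_I hz2]
    have key : Complex.sqrt (-1 / z + 1 + 1) * Complex.sqrt z = Complex.sqrt (2 * (z - 1 / 2)) := by
      have hsq : (Complex.sqrt (-1 / z + 1 + 1) * Complex.sqrt z) ^ 2 =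
          (Complex.sqrt (2 * (z - 1 / 2))) ^ 2 := by
        rw [mul_pow, csqrt_sq, csqrt_sq, csqrt_sq]
        field_simp
        ring
      rcases sq_eq_sq_iff_eq_or_eq_neg.mp hsq with h | h
      · exact h
      · exfalso
        obtain ⟨h1, h2⟩ := csqrt_mem_quadrant hz
        obtain ⟨h3, h4⟩ := csqrt_mem_quadrant hw
        obtain ⟨h5, h6⟩ := csqrt_mem_quadrant hz2
        have := congrArg Complex.im h
        rw [Complex.mul_im, Complex.neg_im] at this
        have h7 := mul_pos h3 h2
        have h8 := mul_pos h4 h1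
        linarith
    rw [← key]
    ring

lemma exp_pi_mul_div_le : Real.exp (π * 0.86 / 12) ≤ 1.3 := by
  have hpi := Real.pi_lt_d2
  have h1 : π * 0.86 / 12 ≤ 0.23 := by linarith
  calc _ ≤ Real.exp 0.23 := Real.exp_le_exp.mpr h1
    _ ≤ 1 / (1 - 0.23) := Real.exp_bound_div_one_sub_of_interval (by norm_num) (by norm_num)
    _ ≤ _ := by norm_num

lemma norm_exp_neg_two_pi_I_mul_div (z : ℂ) :
    ‖Complex.exp (-(2 * π * Complex.I * z / 24))‖ = Real.exp (π * z.im / 12) := by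
  have := norm_exp_two_pi_I_mul z (-(1 / 24))
  rw [show -(2 * π * z.im * (-(1 / 24))) = π * z.im / 12 by ring] at this
  rw [← this]
  push_cast
  ring_nf

/-- Approximation of `1 / η` near a cusp: either the transformed point is high, or both `1 / η`
and the main term are small. -/
lemma eta_inv_cusp {τ : UpperHalfPlane} {w s κ : ℂ} (hy : τ.im ≤ 1 / 327) (hs : ‖s‖ ≤ 0.75)
    (hκ : ‖κ‖ = 1) (hw : 0 < w.im)
    (htr : ModularForm.eta w = κ * s * ModularForm.eta τ)
    (h : w.im < 0.86 → ∀ c d : ℤ, IsCoprime c d → c ^ 2 ≤ 4 →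
      τ.im < 0.86 * Complex.normSq (c * τ + d)) :
    ‖(ModularForm.eta τ)⁻¹ - κ * s * Complex.exp (-(2 * π * Complex.I * w / 24))‖ ≤
      0.26 * Real.exp (π / (108 * τ.im)) + 1 := by
  have hew := ModularForm.eta_ne_zero hw
  have het := ModularForm.eta_ne_zero τ.2
  have hks : κ * s ≠ 0 := by
    intro h0
    rw [h0, zero_mul] at htr
    exact hew htr
  have e : (ModularForm.eta τ)⁻¹ = κ * s * (ModularForm.eta w)⁻¹ := by
    rw [htr, mul_inv, ← mul_assoc, mul_inv_cancel₀ hks, one_mul]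
  rcases le_or_gt 0.86 w.im with h1 | h1
  · rw [e, ← mul_sub, norm_mul, norm_mul, hκ, one_mul]
    have h2 := (eta_inv_approx h1).1
    have h3 := mul_le_mul hs h2 (norm_nonneg _) (by norm_num)
    have := Real.exp_pos (π / (108 * τ.im))
    linarith
  · have h2 := norm_eta_inv_le hy (h h1)
    refine (norm_sub_le _ _).trans (add_le_add h2 ?_)
    rw [norm_mul, norm_mul, hκ, one_mul, norm_exp_neg_two_pi_I_mul_div]
    have h3 : Real.exp (π * w.im / 12) ≤ 1.3 := by
      refine le_trans (Real.exp_le_exp.mpr ?_) exp_pi_mul_div_le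
      gcongr
    nlinarith [norm_nonneg s, Real.exp_pos (π * w.im / 12)]

lemma norm_csqrt_neg_I_mul_le {z : ℂ} (h : Complex.normSq z ≤ 0.07) :
    ‖Complex.sqrt (-Complex.I * z)‖ ≤ 0.53 := by
  have h1 := norm_csqrt_sq (-Complex.I * z)
  rw [norm_mul, norm_neg, Complex.norm_I, one_mul] at h1
  rw [Complex.normSq_eq_norm_sq] at h
  have h2 : ‖z‖ ≤ 0.265 := by
    by_contra h3
    push Not at h3
    nlinarith
  by_contra h3
  push Not at h3
  nlinarith

lemma int_cases_sq_le_four {c : ℤ} (h : c ^ 2 ≤ 4) : -2 ≤ c ∧ c ≤ 2 := by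
  constructor <;> nlinarith

lemma coprime_two_odd {c d : ℤ} (h : IsCoprime c d) (hc : c = 2 ∨ c = -2) : ∃ k, d = 2 * k + 1 := by
  rcases Int.even_or_odd' d with ⟨k, hk | hk⟩
  · exfalso
    obtain ⟨u, v, huv⟩ := h
    rcases hc with rfl | rfl <;> subst hk <;> ring_nf at huv <;> omega
  · exact ⟨k, hk⟩

lemma one_le_sq_of_ne_zero {d : ℤ} (hd : d ≠ 0) : (d : ℝ) ≤ -1 ∨ (1 : ℝ) ≤ d := by
  rcases lt_or_gt_of_ne hd with h | h
  · left; exact_mod_cast (by omega : d ≤ -1)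
  · right; exact_mod_cast h

lemma eta_inv_near_zero {x y : ℝ} (hy : 0 < y) (hy' : y ≤ 1 / 327) (hx : |x| ≤ 1 / 4) :
    ‖(ModularForm.eta (x + y * Complex.I))⁻¹ - Complex.sqrt (y + (-x : ℝ) * Complex.I) *
      Complex.exp ((π / 12 : ℝ) * (y + (-x : ℝ) * Complex.I)⁻¹)‖ ≤
        0.26 * Real.exp (π / (108 * y)) + 1 := by
  obtain ⟨hx1, hx2⟩ := abs_le.mp hx
  set z : ℂ := x + y * Complex.I with hz
  have hzre : z.re = x := by simp [hz]
  have hzim : z.im = y := by simp [hz]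
  have hz0 : z ≠ 0 := by
    intro h; rw [h] at hzim; simp at hzim; linarith
  let τ : UpperHalfPlane := ⟨z, by rw [hzim]; exact hy⟩
  have hτim : τ.im = y := hzim
  have hzi : (y + (-x : ℝ) * Complex.I : ℂ) = -Complex.I * z := by
    rw [hz]; push_cast; linear_combination (y : ℂ) * Complex.I_sq
  have hN : Complex.normSq z = x ^ 2 + y ^ 2 := by
    rw [Complex.normSq_apply, hzre, hzim]; ring
  have hN0 : 0 < Complex.normSq z := Complex.normSq_pos.mpr hz0
  have h := eta_inv_cusp (τ := τ) (w := -1 / z) (s := Complex.sqrt (-Complex.I * z)) (κ := 1)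
    (by rw [hτim]; exact hy') ?_ (by simp) (neg_one_div_im_pos (by rw [hzim]; exact hy)) ?_ ?_
  · rw [hτim] at h
    rw [hzi]
    convert! h using 3
    rw [one_mul]
    congr 2
    push_cast
    have := Complex.I_ne_zero
    field_simp
    linear_combination (-24) * Complex.I_sq
  · refine (norm_csqrt_neg_I_mul_le ?_).trans (by norm_num)
    rw [hN]; nlinarith
  · rw [one_mul]; exact eta_neg_one_div (by rw [hzim]; exact hy)
  · intro hw c d hcd hc
    have hw' : (-1 / z).im = y / (x ^ 2 + y ^ 2) := by
      rw [Complex.div_im, hN, hzim]; simp; ring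
    rw [hw', div_lt_iff₀ (by rw [← hN]; exact hN0)] at hw
    have hns : Complex.normSq (c * (τ : ℂ) + d) = (c * x + d) ^ 2 + (c * y) ^ 2 := by
      rw [Complex.normSq_apply]
      change (c * z + d).re * (c * z + d).re + (c * z + d).im * (c * z + d).im = _
      simp [hzre, hzim]; ring
    rw [hns, hτim]
    obtain ⟨hc1, hc2⟩ := int_cases_sq_le_four hc
    have hd0 : c = 2 ∨ c = -2 → d ≠ 0 := fun h0 ↦ by
      obtain ⟨k, hk⟩ := coprime_two_odd hcd h0; omega
    by_cases hd : d = 0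
    · subst hd
      have : c = 1 ∨ c = -1 := by
        have : c ≠ 0 := by rintro rfl; obtain ⟨u, v, huv⟩ := hcd; simp at huv
        have : c ≠ 2 := fun h ↦ hd0 (Or.inl h) rfl
        have : c ≠ -2 := fun h ↦ hd0 (Or.inr h) rfl
        omega
      rcases this with rfl | rfl <;> push_cast <;> ring_nf <;> ring_nf at hw <;> linarith
    · have h1 : (0.5 : ℝ) ^ 2 ≤ (c * x + d) ^ 2 := by
        rw [sq_le_sq, abs_of_nonneg (by norm_num : (0 : ℝ) ≤ 0.5), le_abs]
        have h2 : (-2 : ℝ) ≤ c := by exact_mod_cast hc1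
        have h3 : (c : ℝ) ≤ 2 := by exact_mod_cast hc2
        rcases one_le_sq_of_ne_zero hd with h4 | h4
        · right; nlinarith
        · left; nlinarith
      nlinarith [sq_nonneg (c * y)]

lemma eta_inv_near_half : ∃ ω : ℂ, ‖ω‖ = 1 ∧ ∀ u y : ℝ, 0 < y → y ≤ 1 / 327 → |u| ≤ 1 / 4 →
    ‖(ModularForm.eta ((1 / 2 + u : ℝ) + y * Complex.I))⁻¹ - ω * (Real.sqrt 2 : ℂ) *
      (Complex.sqrt (y + (-u : ℝ) * Complex.I) *
      Complex.exp ((π / 48 : ℝ) * (y + (-u : ℝ) * Complex.I)⁻¹))‖ ≤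
        0.26 * Real.exp (π / (108 * y)) + 1 := by
  obtain ⟨κ, hκ, htr⟩ := exists_eta_transform_half
  refine ⟨κ * Complex.exp (π * Complex.I / 24), ?_, fun u y hy hy' hu ↦ ?_⟩
  · rw [norm_mul, hκ, Complex.norm_exp]; simp
  obtain ⟨hx1, hx2⟩ := abs_le.mp hu
  set z : ℂ := (1 / 2 + u : ℝ) + y * Complex.I with hz
  have hzre : z.re = 1 / 2 + u := by simp [hz]
  have hzim : z.im = y := by simp [hz]
  have hz0 : z ≠ 0 := by
    intro h; rw [h] at hzim; simp at hzim; linarith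
  have hz1 : z - 1 / 2 ≠ 0 := by
    intro h
    have := congrArg Complex.im h
    simp [hzim] at this; linarith
  let τ : UpperHalfPlane := ⟨z, by rw [hzim]; exact hy⟩
  have hτim : τ.im = y := hzim
  have hzi : (y + (-u : ℝ) * Complex.I : ℂ) = -Complex.I * (z - 1 / 2) := by
    rw [hz]; push_cast; linear_combination (y : ℂ) * Complex.I_sq
  have hw1 : -1 / (-1 / z + 1 + 1) = -1 / 2 - 1 / (4 * (z - 1 / 2)) := by
    have : -1 / z + 1 + 1 ≠ 0 := by
      intro h
      apply hz1
      field_simp at h ⊢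
      linear_combination h
    have h2 : -1 + z + z ≠ 0 := by intro h; apply hz1; linear_combination h / 2
    have h3 : 2 * z - 1 ≠ 0 := by intro h; apply hz1; linear_combination h / 2
    have h4 : -1 / z + 1 + 1 = (2 * z - 1) / z := by field_simp; ring
    have h5 : 4 * (z - 1 / 2) = 2 * (2 * z - 1) := by ring
    rw [h4, h5]
    field_simp
    ring
  have hwim : (-1 / (-1 / z + 1 + 1)).im = y / (4 * (u ^ 2 + y ^ 2)) := by
    rw [hw1, Complex.sub_im, Complex.div_im, Complex.div_im, Complex.normSq_apply,
      Complex.normSq_apply]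
    simp [hzre, hzim]
    have : u ^ 2 + y ^ 2 ≠ 0 := by positivity
    have : 4 * u * (4 * u) + 4 * y * (4 * y) ≠ 0 := by
      have : 0 < 4 * u * (4 * u) + 4 * y * (4 * y) := by nlinarith
      exact this.ne'
    field_simp
  have hN : Complex.normSq (z - 1 / 2) = u ^ 2 + y ^ 2 := by
    rw [Complex.normSq_apply]; simp [hzre, hzim]; ring
  have h := eta_inv_cusp (τ := τ) (w := -1 / (-1 / z + 1 + 1))
    (s := (Real.sqrt 2 : ℂ) * Complex.sqrt (-Complex.I * (z - 1 / 2))) (κ := κ)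
    (by rw [hτim]; exact hy') ?_ hκ (by rw [hwim]; positivity) ?_ ?_
  · rw [hτim] at h
    rw [hzi]
    convert! h using 3
    have : Complex.exp (-(2 * π * Complex.I * (-1 / (-1 / z + 1 + 1)) / 24)) =
        Complex.exp (π * Complex.I / 24) *
          Complex.exp ((π / 48 : ℝ) * (-Complex.I * (z - 1 / 2))⁻¹) := by
      rw [← Complex.exp_add, hw1]
      congr 1
      push_cast
      have := Complex.I_ne_zero
      generalize z - 1 / 2 = w at hz1
      field_simp
      linear_combination (96 : ℂ) * Complex.I_sq
    rw [this]
    ring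
  · rw [norm_mul, Complex.norm_real, Real.norm_of_nonneg (Real.sqrt_nonneg _)]
    have h1 : ‖Complex.sqrt (-Complex.I * (z - 1 / 2))‖ ≤ 0.53 := by
      refine norm_csqrt_neg_I_mul_le ?_
      rw [hN]; nlinarith
    have h2 : Real.sqrt 2 ≤ 1.415 := by
      rw [Real.sqrt_le_left (by norm_num)]; norm_num
    calc _ ≤ 1.415 * (0.53 : ℝ) := by gcongr
      _ ≤ _ := by norm_num
  · exact htr z (by rw [hzim]; exact hy)
  · intro hw c d hcd hc
    rw [hwim, div_lt_iff₀ (by positivity)] at hw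
    have hns : Complex.normSq (c * (τ : ℂ) + d) = (c * (1 / 2 + u) + d) ^ 2 + (c * y) ^ 2 := by
      rw [Complex.normSq_apply]
      change (c * z + d).re * (c * z + d).re + (c * z + d).im * (c * z + d).im = _
      simp [hzre, hzim]; ring
    rw [hns, hτim]
    obtain ⟨hc1, hc2⟩ := int_cases_sq_le_four hc
    suffices h1 : (c * (1 / 2 + u) + d) ^ 2 = (2 * u) ^ 2 ∧ (c : ℝ) ^ 2 = 4 ∨
        (0.25 : ℝ) ^ 2 ≤ (c * (1 / 2 + u) + d) ^ 2 by
      rcases h1 with ⟨h1, h2⟩ | h1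
      · have h3 : (c * y) ^ 2 = 4 * y ^ 2 := by rw [mul_pow, h2]
        rw [h1, h3]; nlinarith
      · nlinarith [sq_nonneg (c * y)]
    have hq : ∀ r : ℝ, r ≤ -0.25 ∨ 0.25 ≤ r → (0.25 : ℝ) ^ 2 ≤ r ^ 2 := by
      intro r hr
      rcases hr with hr | hr <;> nlinarith
    have hcc : c = 0 ∨ c = 1 ∨ c = -1 ∨ (c = 2 ∨ c = -2) := by omega
    have hdd : ∀ e : ℤ, (e : ℝ) ≤ -1 ∨ e = 0 ∨ (1 : ℝ) ≤ e := fun e ↦ by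
      by_cases he : e = 0
      · exact Or.inr (Or.inl he)
      · rcases one_le_sq_of_ne_zero he with h | h <;> simp [h]
    rcases hcc with rfl | rfl | rfl | hc'
    · right
      apply hq
      rcases hdd d with h | rfl | h
      · left; push_cast; linarith
      · obtain ⟨a, b, hab⟩ := hcd; simp at hab
      · right; push_cast; linarith
    · right
      apply hq
      rcases hdd d with h | rfl | h
      · left; push_cast; linarith
      · right; push_cast; linarith
      · right; push_cast; linarith
    · right
      apply hq
      rcases hdd d with h | rfl | h
      · left; push_cast; linarith
      · left; push_cast; linarith
      · right; push_cast; linarith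
    · obtain ⟨k, rfl⟩ := coprime_two_odd hcd hc'
      rcases hc' with rfl | rfl
      · rcases hdd (k + 1) with h | h | h
        · right; apply hq; left; push_cast at h ⊢; linarith
        · left
          obtain rfl : k = -1 := by omega
          push_cast; constructor <;> ring
        · right; apply hq; right; push_cast at h ⊢; linarith
      · rcases hdd k with h | rfl | h
        · right; apply hq; left; push_cast at h ⊢; linarith
        · left
          push_cast; constructor <;> ring
        · right; apply hq; right; push_cast at h ⊢; linarith

/-- The Taylor series at `0` of a complex function, as a formal power series. -/
noncomputable def taylorPowerSeries (f : ℂ → ℂ) : PowerSeries ℂ :=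
  PowerSeries.mk fun n ↦ (n.factorial : ℂ)⁻¹ * iteratedDeriv n f 0

lemma taylorPowerSeries_mul {f g : ℂ → ℂ} (hf : AnalyticAt ℂ f 0) (hg : AnalyticAt ℂ g 0) :
    taylorPowerSeries (f * g) = taylorPowerSeries f * taylorPowerSeries g := by
  ext n
  rw [PowerSeries.coeff_mul]
  simp only [taylorPowerSeries, PowerSeries.coeff_mk]
  rw [iteratedDeriv_mul hf.contDiffAt hg.contDiffAt, Finset.Nat.sum_antidiagonal_eq_sum_range_succ
    (fun i j ↦ (i.factorial : ℂ)⁻¹ * iteratedDeriv i f 0 *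
      ((j.factorial : ℂ)⁻¹ * iteratedDeriv j g 0)), Finset.mul_sum]
  refine Finset.sum_congr rfl fun i hi ↦ ?_
  have hi' : i ≤ n := Nat.lt_succ_iff.mp (Finset.mem_range.mp hi)
  rw [Nat.cast_choose ℂ hi']
  have h1 := n.factorial_ne_zero
  have h2 := i.factorial_ne_zero
  have h3 := (n - i).factorial_ne_zero
  field_simp

lemma taylorPowerSeries_one : taylorPowerSeries 1 = 1 := by
  ext n
  simp only [taylorPowerSeries, PowerSeries.coeff_mk, PowerSeries.coeff_one]
  rw [show (1 : ℂ → ℂ) = fun _ ↦ 1 from rfl, iteratedDeriv_const]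
  split_ifs with h <;> simp [h]

lemma taylorPowerSeries_one_sub_pow (k : ℕ) :
    taylorPowerSeries (fun q ↦ 1 - q ^ k) = 1 - PowerSeries.X ^ k := by
  ext n
  rw [map_sub, PowerSeries.coeff_one, PowerSeries.coeff_X_pow]
  simp only [taylorPowerSeries, PowerSeries.coeff_mk]
  have := iteratedDeriv_sub (n := n) (x := (0 : ℂ)) (f := fun _ ↦ (1 : ℂ)) (g := fun q ↦ q ^ k)
    contDiffAt_const (by fun_prop)
  rw [show (fun q : ℂ ↦ 1 - q ^ k) = (fun _ ↦ (1 : ℂ)) - fun q ↦ q ^ k from rfl, this,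
    iteratedDeriv_const, iteratedDeriv_fun_pow_zero]
  have h1 : (n.factorial : ℂ) ≠ 0 := by exact_mod_cast n.factorial_ne_zero
  split_ifs with h h' h' <;> simp_all

lemma taylorPowerSeries_prod (s : Finset ℕ) :
    taylorPowerSeries (fun q ↦ ∏ i ∈ s, (1 - q ^ (i + 1))) =
      ∏ i ∈ s, (1 - PowerSeries.X ^ (i + 1)) := by
  induction s using Finset.cons_induction with
  | empty => simpa using! taylorPowerSeries_one
  | cons a s ha ih =>
    rw [Finset.prod_cons, ← ih, ← taylorPowerSeries_one_sub_pow, ← taylorPowerSeries_mul]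
    · congr 1
      ext q
      rw [Finset.prod_cons]; rfl
    · fun_prop
    · fun_prop

lemma tendstoLocallyUniformlyOn_iteratedDeriv {ι : Type*} {F : ι → ℂ → ℂ} {f : ℂ → ℂ}
    {l : Filter ι} {U : Set ℂ} (hU : IsOpen U) (hF : ∀ i, Differentiable ℂ (F i))
    (h : TendstoLocallyUniformlyOn F f l U) (n : ℕ) :
    TendstoLocallyUniformlyOn (fun i ↦ iteratedDeriv n (F i)) (iteratedDeriv n f) l U := by
  induction n with
  | zero => simpa using h
  | succ n ih =>
    have h1 := ih.deriv (.of_forall fun i ↦ ?_) hU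
    · simpa [iteratedDeriv_succ, Function.comp_def] using h1
    · exact ((hF i).contDiff.differentiable_iteratedDeriv n
        (by simpa using! WithTop.coe_lt_coe.mpr (ENat.natCast_lt_top n))).differentiableOn

lemma taylorPowerSeries_tprod :
    taylorPowerSeries (fun q ↦ ∏' n : ℕ, (1 - q ^ (n + 1))) = PowerSeries.pentagonalSeries ℂ := by
  ext n
  have h := ModularForm.multipliableLocallyUniformlyOn_one_sub_pow.hasProdLocallyUniformlyOn
  rw [hasProdLocallyUniformlyOn_iff_tendstoLocallyUniformlyOn] at h
  have h1 := (tendstoLocallyUniformlyOn_iteratedDeriv Metric.isOpen_ball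
    (fun i ↦ by fun_prop) h n).tendsto_at (Metric.mem_ball_self one_pos)
  have h2 := h1.const_mul (n.factorial : ℂ)⁻¹
  have h3 := PowerSeries.coeff_prod_one_sub_X_pow_eventually_eq ℂ n
  have h4 := h2.congr' (f₂ := fun _ ↦ (PowerSeries.pentagonalSeries ℂ).coeff n) (by
    filter_upwards [h3] with s hs
    rw [← hs, ← taylorPowerSeries_prod]
    simp [taylorPowerSeries])
  simpa [taylorPowerSeries] using tendsto_nhds_unique h4 tendsto_const_nhds

/-- The generating function of the number of partitions. -/
noncomputable def partitionSeries (R : Type*) [CommRing R] : PowerSeries R :=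
  PowerSeries.mk fun n ↦ (Fintype.card (Nat.Partition n) : R)

open PowerSeries.WithPiTopology in
lemma partitionSeries_mul_pentagonalSeries (R : Type*) [CommRing R] :
    partitionSeries R * PowerSeries.pentagonalSeries R = 1 := by
  let : TopologicalSpace R := ⊥
  have : DiscreteTopology R := ⟨rfl⟩
  have h1 := Nat.Partition.hasProd_powerSeriesMk_card_restricted R (fun _ ↦ True)
  have h2 : (PowerSeries.mk fun n ↦ (#(Nat.Partition.restricted n (fun _ ↦ True)) : R)) =
      partitionSeries R := by
    ext n
    simp [partitionSeries, Nat.Partition.restricted]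
  rw [h2] at h1
  have h3 := h1.mul (PowerSeries.WithPiTopology.hasProd_one_sub_X_pow R)
  refine h3.unique ?_
  convert! (hasProd_one : HasProd (fun _ : ℕ ↦ (1 : PowerSeries R)) 1) using 1
  ext1 i
  simp only [if_true, pow_mul]
  exact PowerSeries.WithPiTopology.tsum_pow_mul_one_sub_of_constantCoeff_eq_zero (by simp)

lemma tprod_one_sub_pow_ne_zero {q : ℂ} (hq : ‖q‖ < 1) : ∏' n : ℕ, (1 - q ^ (n + 1)) ≠ 0 := by
  simp_rw [sub_eq_add_neg]
  refine tprod_one_add_ne_zero_of_summable (f := fun n ↦ -q ^ (n + 1)) (fun n ↦ ?_) ?_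
  · rw [← sub_eq_add_neg, sub_ne_zero]
    intro h
    have h1 : ‖q ^ (n + 1)‖ < 1 := by
      rw [norm_pow]; exact pow_lt_one₀ (norm_nonneg _) hq (by omega)
    rw [← h] at h1
    simp at h1
  · simpa using (summable_nat_add_iff 1).mpr (summable_geometric_of_lt_one (norm_nonneg _) hq)

/-- The analytic generating function of the number of partitions. -/
noncomputable def partitionGF (q : ℂ) : ℂ := (∏' n : ℕ, (1 - q ^ (n + 1)))⁻¹

lemma differentiableOn_partitionGF : DifferentiableOn ℂ partitionGF (Metric.ball 0 1) :=
  ModularForm.differentiableOn_tprod_one_sub_pow.inv fun _ hq ↦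
    tprod_one_sub_pow_ne_zero (by simpa using hq)

lemma taylorPowerSeries_partitionGF : taylorPowerSeries partitionGF = partitionSeries ℂ := by
  have hmem : Metric.ball (0 : ℂ) 1 ∈ 𝓝 0 := Metric.ball_mem_nhds _ one_pos
  have h1 := differentiableOn_partitionGF.analyticAt hmem
  have h2 := ModularForm.differentiableOn_tprod_one_sub_pow.analyticAt hmem
  have h3 := taylorPowerSeries_mul h1 h2
  rw [taylorPowerSeries_tprod] at h3
  have h4 : taylorPowerSeries (partitionGF * fun q ↦ ∏' n : ℕ, (1 - q ^ (n + 1))) = 1 := by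
    rw [← taylorPowerSeries_one]
    ext n
    simp only [taylorPowerSeries, PowerSeries.coeff_mk]
    congr 1
    apply Filter.EventuallyEq.iteratedDeriv_eq
    filter_upwards [hmem] with q hq
    exact inv_mul_cancel₀ (tprod_one_sub_pow_ne_zero (by simpa using hq))
  rw [h4] at h3
  have h5 := partitionSeries_mul_pentagonalSeries ℂ
  calc _ = taylorPowerSeries partitionGF *
        (partitionSeries ℂ * PowerSeries.pentagonalSeries ℂ) := by
        rw [h5, mul_one]
    _ = taylorPowerSeries partitionGF * PowerSeries.pentagonalSeries ℂ * partitionSeries ℂ :=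
        by ring
    _ = _ := by rw [← h3, one_mul]

lemma partitionGF_exp {z : ℂ} : partitionGF (Complex.exp (2 * π * Complex.I * z)) =
    Complex.exp (2 * π * Complex.I * z / 24) * (ModularForm.eta z)⁻¹ := by
  rw [eta_eq_exp_mul_tprod, mul_inv, mul_inv_cancel_left₀ (Complex.exp_ne_zero _), partitionGF]

/-- The number of partitions as a Fourier coefficient of `1 / η`. -/
lemma card_partition_eq_integral (n : ℕ) {y : ℝ} (hy : 0 < y) (a : ℝ) :
    (Fintype.card (Nat.Partition n) : ℂ) = ∫ x in a..(a + 1),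
      (ModularForm.eta (x + y * Complex.I))⁻¹ *
        Complex.exp (-(2 * π * Complex.I * (n - 1 / 24) * (x + y * Complex.I))) := by
  have hr : 0 < Real.exp (-(2 * π * y)) := Real.exp_pos _
  have hr1 : Real.exp (-(2 * π * y)) < 1 := by
    rw [Real.exp_lt_one_iff]; have := Real.pi_pos; nlinarith [mul_pos this hy]
  set r := Real.exp (-(2 * π * y)) with hrdef
  have h1 := (differentiableOn_partitionGF.mono
    (Metric.closedBall_subset_ball hr1)).circleIntegral_one_div_sub_center_pow_smul hr n
  have h2 : (Fintype.card (Nat.Partition n) : ℂ) =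
      (n.factorial : ℂ)⁻¹ * iteratedDeriv n partitionGF 0 := by
    have := congrArg (PowerSeries.coeff n) taylorPowerSeries_partitionGF
    simpa [taylorPowerSeries, partitionSeries] using this.symm
  have h3 : (Fintype.card (Nat.Partition n) : ℂ) = (2 * π * Complex.I)⁻¹ *
      ∮ z in C(0, r), (1 / (z - 0) ^ (n + 1)) • partitionGF z := by
    rw [h1, h2, smul_eq_mul]
    have := Complex.two_pi_I_ne_zero
    field_simp
  have hInt : ∀ x : ℝ, (ModularForm.eta (x + y * Complex.I))⁻¹ *
        Complex.exp (-(2 * π * Complex.I * (n - 1 / 24) * (x + y * Complex.I))) =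
      partitionGF (circleMap 0 r (2 * π * x)) * (circleMap 0 r (2 * π * x))⁻¹ ^ n := by
    intro x
    have hc : circleMap 0 r (2 * π * x) =
        Complex.exp (2 * π * Complex.I * (x + y * Complex.I)) := by
      rw [circleMap, zero_add, hrdef, Complex.ofReal_exp, ← Complex.exp_add]
      congr 1
      push_cast
      linear_combination (-2 * π * y) * Complex.I_sq
    rw [hc, partitionGF_exp, ← Complex.exp_neg, ← Complex.exp_nat_mul, mul_comm,
      mul_right_comm (Complex.exp _), ← Complex.exp_add]
    congr 2
    ring
  have hper : Function.Periodic (fun x : ℝ ↦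
      partitionGF (circleMap 0 r (2 * π * x)) * (circleMap 0 r (2 * π * x))⁻¹ ^ n) 1 := by
    intro x
    have : circleMap 0 r (2 * π * (x + 1)) = circleMap 0 r (2 * π * x) := by
      rw [mul_add, mul_one]; exact periodic_circleMap 0 r _
    simp only [this]
  simp_rw [hInt]
  rw [hper.intervalIntegral_add_eq a 0, zero_add, h3, circleIntegral]
  have h5 := intervalIntegral.smul_integral_comp_mul_left (a := 0) (b := 1) (fun θ ↦
    partitionGF (circleMap 0 r θ) * (circleMap 0 r θ)⁻¹ ^ n) (2 * π)
  rw [mul_zero, mul_one] at h5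
  have h6 : ∀ θ : ℝ, deriv (circleMap 0 r) θ • (1 / (circleMap 0 r θ - 0) ^ (n + 1)) •
      partitionGF (circleMap 0 r θ) = Complex.I *
        (partitionGF (circleMap 0 r θ) * (circleMap 0 r θ)⁻¹ ^ n) := by
    intro θ
    have hne : circleMap 0 r θ ≠ 0 := circleMap_ne_center hr.ne'
    rw [deriv_circleMap, sub_zero, smul_eq_mul, smul_eq_mul, pow_succ]
    generalize circleMap 0 r θ = w at hne ⊢
    rw [inv_pow]
    field_simp
  simp_rw [h6]
  rw [intervalIntegral.integral_const_mul, ← h5, Complex.real_smul]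
  push_cast
  have := Complex.I_ne_zero
  have := Real.pi_ne_zero
  field_simp

lemma norm_integral_sub_le {F G : ℝ → ℂ} {a b K : ℝ} (hF : Continuous F) (hG : Continuous G)
    (hab : a ≤ b) (h : ∀ x, a ≤ x → x ≤ b → ‖F x - G x‖ ≤ K) :
    ‖(∫ x in a..b, F x) - ∫ x in a..b, G x‖ ≤ K * (b - a) := by
  rw [← intervalIntegral.integral_sub (hF.intervalIntegrable _ _) (hG.intervalIntegrable _ _),
    ← abs_of_nonneg (sub_nonneg.mpr hab)]
  refine intervalIntegral.norm_integral_le_of_norm_le_const fun x hx ↦ ?_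
  rw [Set.uIoc_of_le hab] at hx
  exact h x hx.1.le hx.2

lemma continuous_csqrt_line {y : ℝ} (hy : 0 < y) :
    Continuous fun v : ℝ ↦ Complex.sqrt (y + v * Complex.I) := by
  unfold Complex.sqrt
  refine Continuous.cpow (by fun_prop) continuous_const fun v ↦ ?_
  left
  simpa using hy

lemma continuous_eta_inv_line {y : ℝ} (hy : 0 < y) :
    Continuous fun x : ℝ ↦ (ModularForm.eta (x + y * Complex.I))⁻¹ := by
  rw [continuous_iff_continuousAt]
  intro x
  have him : 0 < (x + y * Complex.I : ℂ).im := by simpa using hy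
  refine ContinuousAt.inv₀ ?_ (ModularForm.eta_ne_zero him)
  have h1 : ContinuousAt ModularForm.eta (x + y * Complex.I) :=
    (ModularForm.differentiableAt_eta_of_mem_upperHalfPlaneSet him).continuousAt
  exact ContinuousAt.comp (f := fun x : ℝ ↦ (x + y * Complex.I : ℂ)) h1 (by fun_prop)

/-- The saddle point main term in the circle method. -/
noncomputable def hankelMain (A B : ℝ) : ℝ :=
  Real.sqrt (π / A) / A * (2 * Real.sqrt (A * B) * Real.sinh (2 * Real.sqrt (A * B)) -
    Real.cosh (2 * Real.sqrt (A * B)))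

lemma integral_csqrt_neg_approx {A B y : ℝ} (hA : 2 ≤ A) (hB : 0 ≤ B) (hB' : B ≤ π / 12)
    (hy : 0 < y) (hy' : y ≤ 1 / 100) :
    ‖(∫ x in (-(1 / 4) : ℝ)..(1 / 4), Complex.sqrt (y + (-x : ℝ) * Complex.I) *
        Complex.exp (B * (y + (-x : ℝ) * Complex.I)⁻¹) *
        Complex.exp (A * (y + (-x : ℝ) * Complex.I))) - (hankelMain A B : ℂ)‖ ≤
      15 * Real.exp (A * y) := by
  have h := integral_csqrt_approx hA hB hB' hy hy'
  have h1 := intervalIntegral.integral_comp_neg (a := -(1 / 4)) (b := (1 / 4 : ℝ))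
    (fun v : ℝ ↦ Complex.sqrt (y + v * Complex.I) *
        Complex.exp (A * (y + v * Complex.I) + B * (y + v * Complex.I)⁻¹))
  rw [neg_neg] at h1
  rw [← h1] at h
  rw [hankelMain]
  convert! h using 4
  ext x
  rw [Complex.exp_add]
  ring

lemma norm_exp_mul_line (A y v : ℝ) :
    ‖Complex.exp (A * (y + v * Complex.I))‖ = Real.exp (A * y) := by
  rw [Complex.norm_exp]; simp

lemma card_partition_approx (n : ℕ) {y : ℝ} (hy : 0 < y) (hy' : y ≤ 1 / 327) (hn : 1 ≤ n) :
    |(Fintype.card (Nat.Partition n) : ℝ) - hankelMain (2 * π * (n - 1 / 24)) (π / 12)| ≤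
      Real.sqrt 2 * |hankelMain (2 * π * (n - 1 / 24)) (π / 48)| +
        (15 * (1 + Real.sqrt 2) + (0.26 * Real.exp (π / (108 * y)) + 1)) *
          Real.exp (2 * π * (n - 1 / 24) * y) := by
  have hpi := Real.pi_gt_three
  have hn1 : (1 : ℝ) ≤ n := by exact_mod_cast hn
  set A : ℝ := 2 * π * (n - 1 / 24) with hA
  have hA2 : 2 ≤ A := by rw [hA]; nlinarith
  set K : ℝ := 0.26 * Real.exp (π / (108 * y)) + 1
  obtain ⟨ω, hω, hhalf⟩ := eta_inv_near_half
  set F : ℝ → ℂ := fun x ↦ (ModularForm.eta (x + y * Complex.I))⁻¹ *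
        Complex.exp (-(2 * π * Complex.I * (n - 1 / 24) * (x + y * Complex.I))) with hF
  have hFc : Continuous F := (continuous_eta_inv_line hy).mul (by fun_prop)
  have hFexp : ∀ x : ℝ, F x = (ModularForm.eta (x + y * Complex.I))⁻¹ *
      Complex.exp (A * (y + (-x : ℝ) * Complex.I)) := by
    intro x
    simp only [hF, hA]
    congr 2
    push_cast
    linear_combination (-2 * π * (n - 1 / 24) * y : ℂ) * Complex.I_sq
  have hp := card_partition_eq_integral n hy (-(1 / 4))
  have hsplit : (Fintype.card (Nat.Partition n) : ℂ) =
      (∫ x in (-(1 / 4) : ℝ)..(1 / 4), F x) + ∫ u in (-(1 / 4) : ℝ)..(1 / 4), F (1 / 2 + u) := by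
    rw [hp, intervalIntegral.integral_comp_add_left,
        ← intervalIntegral.integral_add_adjacent_intervals
      (hFc.intervalIntegrable (-(1 / 4)) (1 / 4)) (hFc.intervalIntegrable (1 / 4) _)]
    congr 2 <;> norm_num
  set G : ℝ → ℝ → ℂ := fun B x ↦ Complex.sqrt (y + (-x : ℝ) * Complex.I) *
        Complex.exp (B * (y + (-x : ℝ) * Complex.I)⁻¹) *
        Complex.exp (A * (y + (-x : ℝ) * Complex.I)) with hG
  have hGc : ∀ B, Continuous (G B) := by
    intro B
    refine Continuous.mul (Continuous.mul ?_ ?_) (by fun_prop)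
    · exact (continuous_csqrt_line hy).comp (continuous_neg)
    · refine Complex.continuous_exp.comp (continuous_const.mul (Continuous.inv₀ (by fun_prop) ?_))
      intro x h0
      have := congrArg Complex.re h0
      simp at this
      exact hy.ne' this
  have hB1 := integral_csqrt_neg_approx hA2 (B := π / 12) (by positivity) le_rfl hy (by linarith)
  have hB2 := integral_csqrt_neg_approx hA2 (B := π / 48) (by positivity) (by linarith) hy
    (by linarith)
  have h1 : ‖(∫ x in (-(1 / 4) : ℝ)..(1 / 4), F x) - ∫ x in (-(1 / 4) : ℝ)..(1 / 4), G (π / 12) x‖ ≤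
      K * Real.exp (A * y) * (1 / 4 - -(1 / 4)) := by
    refine norm_integral_sub_le hFc (hGc _) (by norm_num) fun x hx1 hx2 ↦ ?_
    rw [hFexp, hG, ← sub_mul, norm_mul, norm_exp_mul_line]
    gcongr
    exact eta_inv_near_zero hy hy' (abs_le.mpr ⟨hx1, hx2⟩)
  set ω' : ℂ := ω * (Real.sqrt 2 : ℂ) * Complex.exp (-(A / 2 * Complex.I)) with hω'
  have hω'n : ‖ω'‖ = Real.sqrt 2 := by
    rw [hω', norm_mul, norm_mul, hω, Complex.norm_real, Complex.norm_exp,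
      Real.norm_of_nonneg (Real.sqrt_nonneg _)]
    simp
  have h2 : ‖(∫ u in (-(1 / 4) : ℝ)..(1 / 4), F (1 / 2 + u)) -
      ∫ u in (-(1 / 4) : ℝ)..(1 / 4), ω' * G (π / 48) u‖ ≤
      K * Real.exp (A * y) * (1 / 4 - -(1 / 4)) := by
    refine norm_integral_sub_le (by fun_prop) (continuous_const.mul (hGc _)) (by norm_num)
      fun u hx1 hx2 ↦ ?_
    have e1 : F (1 / 2 + u) = (ModularForm.eta ((1 / 2 + u : ℝ) + y * Complex.I))⁻¹ *
      Complex.exp (A * (y + (-u : ℝ) * Complex.I)) * Complex.exp (-(A / 2 * Complex.I)) := by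
      rw [hFexp, mul_assoc, ← Complex.exp_add]
      congr 2
      push_cast
      ring
    have e2 : F (1 / 2 + u) - ω' * G (π / 48) u =
        ((ModularForm.eta ((1 / 2 + u : ℝ) + y * Complex.I))⁻¹ - ω * (Real.sqrt 2 : ℂ) *
          (Complex.sqrt (y + (-u : ℝ) * Complex.I) *
            Complex.exp ((π / 48 : ℝ) * (y + (-u : ℝ) * Complex.I)⁻¹))) *
        Complex.exp (A * (y + (-u : ℝ) * Complex.I)) * Complex.exp (-(A / 2 * Complex.I)) := by
      rw [e1, hG, hω']
      ring
    have e3 : ‖Complex.exp (-(A / 2 * Complex.I))‖ = 1 := by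
      rw [Complex.norm_exp]; simp
    rw [e2, norm_mul, e3, mul_one, norm_mul, norm_exp_mul_line]
    gcongr
    exact hhalf u y hy hy' (abs_le.mpr ⟨hx1, hx2⟩)
  rw [intervalIntegral.integral_const_mul] at h2
  have h3 : ‖ω' * ((∫ u in (-(1 / 4) : ℝ)..(1 / 4), G (π / 48) u) - (hankelMain A (π / 48) : ℂ))‖ ≤
      Real.sqrt 2 * (15 * Real.exp (A * y)) := by
    rw [norm_mul, hω'n]
    gcongr
  have h4 : ‖ω' * (hankelMain A (π / 48) : ℂ)‖ = Real.sqrt 2 * |hankelMain A (π / 48)| := by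
    rw [norm_mul, hω'n, Complex.norm_real, Real.norm_eq_abs]
  have h5 : |(Fintype.card (Nat.Partition n) : ℝ) - hankelMain A (π / 12)| =
      ‖(Fintype.card (Nat.Partition n) : ℂ) - (hankelMain A (π / 12) : ℂ)‖ := by
    rw [← Real.norm_eq_abs, ← Complex.norm_real]
    push_cast
    rfl
  rw [h5, hsplit]
  set I1 := ∫ x in (-(1 / 4) : ℝ)..(1 / 4), F x
  set I2 := ∫ u in (-(1 / 4) : ℝ)..(1 / 4), F (1 / 2 + u)
  set J1 := ∫ x in (-(1 / 4) : ℝ)..(1 / 4), G (π / 12) x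
  set J2 := ∫ x in (-(1 / 4) : ℝ)..(1 / 4), G (π / 48) x
  have e : I1 + I2 - (hankelMain A (π / 12) : ℂ) = (I1 - J1) + (J1 - (hankelMain A (π / 12) : ℂ)) +
      (I2 - ω' * J2) + ω' * (J2 - (hankelMain A (π / 48) : ℂ)) +
        ω' * (hankelMain A (π / 48) : ℂ) := by
    ring
  rw [e]
  refine (norm_add_le _ _).trans ?_
  rw [h4]
  have t1 := norm_add_le (I1 - J1 + (J1 - (hankelMain A (π / 12) : ℂ)) + (I2 - ω' * J2))
    (ω' * (J2 - (hankelMain A (π / 48) : ℂ)))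
  have t2 := norm_add_le (I1 - J1 + (J1 - (hankelMain A (π / 12) : ℂ))) (I2 - ω' * J2)
  have t3 := norm_add_le (I1 - J1) (J1 - (hankelMain A (π / 12) : ℂ))
  linarith

lemma hankelMain_eq {s B X : ℝ} (hs : 0 < s) (hX : 0 ≤ X) (hB : B = 3 * X ^ 2 / (π * s ^ 2)) :
    hankelMain (π * s ^ 2 / 12) B =
      12 * Real.sqrt 12 / (π * s ^ 3) * (X * Real.sinh X - Real.cosh X) := by
  have hpi := Real.pi_pos
  have h1 : 2 * Real.sqrt (π * s ^ 2 / 12 * B) = X := by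
    have : π * s ^ 2 / 12 * B = (X / 2) ^ 2 := by rw [hB]; field_simp; ring
    rw [this, Real.sqrt_sq (by positivity)]; ring
  have h2 : Real.sqrt (π / (π * s ^ 2 / 12)) = Real.sqrt 12 / s := by
    have : π / (π * s ^ 2 / 12) = 12 / s ^ 2 := by field_simp
    rw [this, Real.sqrt_div (by norm_num), Real.sqrt_sq hs.le]
  rw [hankelMain, h1, h2]
  congr 1
  field_simp

lemma exp_ge_sq {t : ℝ} (ht : 9 ≤ t) : 39.5 * t ^ 2 ≤ Real.exp t := by
  have h1 : (7625 : ℝ) ≤ Real.exp 9 := by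
    have h := Real.exp_one_gt_d9
    have : Real.exp 9 = Real.exp 1 ^ 9 := by rw [← Real.exp_nat_mul]; norm_num
    rw [this]
    calc (7625 : ℝ) ≤ 2.7 ^ 9 := by norm_num
      _ ≤ _ := by gcongr; linarith
  have h2 := Real.quadratic_le_exp_of_nonneg (x := t - 9) (by linarith)
  have h3 : Real.exp t = Real.exp 9 * Real.exp (t - 9) := by rw [← Real.exp_add]; ring_nf
  have h4 : 7625 * (1 + (t - 9) + (t - 9) ^ 2 / 2) ≤ Real.exp t := by
    rw [h3]
    have : 0 ≤ 1 + (t - 9) + (t - 9) ^ 2 / 2 := by nlinarith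
    gcongr
  nlinarith

lemma abs_sinh_sub_cosh_div_le {X : ℝ} (hX : 2 ≤ X) :
    |X * Real.sinh X - Real.cosh X| ≤ X * (Real.exp X / 2) := by
  rw [Real.sinh_eq, Real.cosh_eq, abs_le]
  have h1 := Real.exp_pos X
  have h2 := Real.exp_pos (-X)
  have h3 : Real.exp (-X) ≤ Real.exp X := Real.exp_le_exp.mpr (by linarith)
  constructor <;> nlinarith

/-- The main term of the asymptotic expansion of the number of partitions. -/
noncomputable def partitionMain (n : ℕ) : ℝ :=
  Real.sqrt 12 / (24 * n - 1) * (1 - (π / 6 * Real.sqrt (24 * n - 1))⁻¹) *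
    Real.exp (π / 6 * Real.sqrt (24 * n - 1))

lemma large_numeric_bound {q S E : ℝ} (hq0 : 3.464 ≤ q) (hs11990 : 11990 ≤ S)
    (hES : 0.3 * S ≤ E) (hE3000 : 3000 ≤ E) :
    q / S * 2 + 1.4143 * (q / S * (E ^ 3 / 2)) + (37.3 + 0.26 * E) * E ≤
      q * E ^ 3 / (S + 1) := by
  have hE0 : 0 < E := by linarith
  have hS : 0 < S := by linarith
  have f1 : q * E ^ 3 / S * 0.9999 ≤ q * E ^ 3 / (S + 1) := by
    rw [div_mul_eq_mul_div, div_le_div_iff₀ hS (by linarith)]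
    have : 0 < q * E ^ 3 := by positivity
    nlinarith
  refine le_trans ?_ f1
  have f2 : (37.3 + 0.26 * E) * E = ((37.3 + 0.26 * E) * E * S) / S := by field_simp
  have f3 : q / S * 2 + 1.4143 * (q / S * (E ^ 3 / 2)) + (37.3 + 0.26 * E) * E ≤
      (q * E ^ 3 * 0.9999) / S := by
    rw [f2]
    have : q / S * 2 + 1.4143 * (q / S * (E ^ 3 / 2)) + ((37.3 + 0.26 * E) * E * S) / S =
      (q * 2 + 1.4143 * (q * (E ^ 3 / 2)) + (37.3 + 0.26 * E) * E * S) / S := by ring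
    rw [this]
    apply div_le_div_of_nonneg_right _ hS.le
    have g1 : (37.3 + 0.26 * E) * E * S ≤ (37.3 + 0.26 * E) * E * (E / 0.3) := by
      gcongr
      rw [le_div_iff₀ (by norm_num)]; linarith
    have g2 : 37.3 + 0.26 * E ≤ 0.273 * E := by linarith
    have g3 : (37.3 + 0.26 * E) * E * (E / 0.3) ≤ 0.273 * E * E * (E / 0.3) := by gcongr
    have g4 : 0.273 * E * E * (E / 0.3) = 0.91 * E ^ 3 := by ring
    have g5 : 3.464 * E ^ 3 ≤ q * E ^ 3 := by gcongr
    have g6 : (3000 : ℝ) ^ 3 ≤ E ^ 3 := by gcongr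
    nlinarith
  linarith [f3, (by ring : q * E ^ 3 / S * 0.9999 = (q * E ^ 3 * 0.9999) / S)]

lemma partition_approx_of_large {n : ℕ} (hn : 500 ≤ n) :
    |(Fintype.card (Nat.Partition n) : ℝ) - partitionMain n| ≤
      Real.exp (π / 2 * Real.sqrt (2 * n / 3)) / (4 * Real.sqrt 3 * n) := by
  have hpi := Real.pi_gt_d4
  have hpi' := Real.pi_lt_d4
  have hn' : (500 : ℝ) ≤ n := by exact_mod_cast hn
  set s := Real.sqrt (24 * n - 1) with hs
  have hs2 : s ^ 2 = 24 * n - 1 := Real.sq_sqrt (by linarith)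
  have hs109 : 109.5 ≤ s := by
    apply Real.le_sqrt_of_sq_le; linarith
  have hs0 : 0 < s := by linarith
  have hA : 2 * π * ((n : ℝ) - 1 / 24) = π * s ^ 2 / 12 := by rw [hs2]; ring
  have key := card_partition_approx n (y := 1 / (3 * s)) (by positivity)
    (by apply one_div_le_one_div_of_le <;> linarith) (by omega)
  set μ := π / 6 * s with hμ
  have hμ54 : 54 ≤ μ := by rw [hμ]; nlinarith
  set E := Real.exp (μ / 6) with hE
  have hE3 : Real.exp (μ / 2) = E ^ 3 := by rw [hE, ← Real.exp_nat_mul]; ring_nf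
  have hE0 : 0 < E := Real.exp_pos _
  rw [hA, hankelMain_eq (X := μ) hs0 (by linarith) (by rw [hμ]; field_simp; ring),
    hankelMain_eq (X := μ / 2) hs0 (by linarith) (by rw [hμ]; field_simp; ring),
    show π / (108 * (1 / (3 * s))) = μ / 6 by rw [hμ]; field_simp; ring,
    show π * s ^ 2 / 12 * (1 / (3 * s)) = μ / 6 by rw [hμ]; field_simp; ring] at key
  have hES : 0.3 * s ^ 2 ≤ E := by
    have := exp_ge_sq (t := μ / 6) (by linarith)
    refine le_trans ?_ this
    have h1 : 3.14 / 36 * s ≤ μ / 6 := by rw [hμ]; nlinarith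
    nlinarith
  set q := Real.sqrt 12 with hq
  have hq2 : q ^ 2 = 12 := Real.sq_sqrt (by norm_num)
  have hq0 : 3.464 ≤ q := by apply Real.le_sqrt_of_sq_le; norm_num
  have hq1 : q ≤ 3.4642 := by rw [hq, Real.sqrt_le_left (by norm_num)]; norm_num
  have hr1 : Real.sqrt 2 ≤ 1.4143 := by rw [Real.sqrt_le_left (by norm_num)]; norm_num
  have hcoef : 12 * q / (π * s ^ 3) = q / s ^ 2 * (2 / μ) := by rw [hμ]; field_simp; ring
  have hH2 : |12 * q / (π * s ^ 3) * (μ / 2 * Real.sinh (μ / 2) - Real.cosh (μ / 2))| ≤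
      q / s ^ 2 * (E ^ 3 / 2) := by
    rw [abs_mul, hcoef, abs_of_nonneg (by positivity)]
    have := abs_sinh_sub_cosh_div_le (X := μ / 2) (by linarith)
    rw [hE3] at this
    calc _ ≤ q / s ^ 2 * (2 / μ) * (μ / 2 * (E ^ 3 / 2)) := by gcongr
      _ = _ := by field_simp
  have hH1 : |12 * q / (π * s ^ 3) * (μ * Real.sinh μ - Real.cosh μ) - partitionMain n| ≤
      q / s ^ 2 * 2 := by
    have e : 12 * q / (π * s ^ 3) * (μ * Real.sinh μ - Real.cosh μ) - partitionMain n =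
        -(q / s ^ 2 * ((1 + μ⁻¹) * Real.exp (-μ))) := by
      rw [hcoef, partitionMain, ← hs, ← hs2, ← hμ, Real.sinh_eq, Real.cosh_eq]
      have : μ ≠ 0 := by linarith
      field_simp
      ring
    rw [e, abs_neg, abs_of_nonneg (by positivity)]
    have h1 : μ⁻¹ ≤ 1 := inv_le_one_of_one_le₀ (by linarith)
    have h2 : Real.exp (-μ) ≤ 1 := Real.exp_le_one_iff.mpr (by linarith)
    have h3 := Real.exp_pos (-μ)
    gcongr
    nlinarith [inv_nonneg.mpr (by linarith : 0 ≤ μ)]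
  have hRHS : q * E ^ 3 / (s ^ 2 + 1) ≤
      Real.exp (π / 2 * Real.sqrt (2 * n / 3)) / (4 * Real.sqrt 3 * n) := by
    have h3 : 4 * Real.sqrt 3 * n = (s ^ 2 + 1) / q := by
      have : q = 2 * Real.sqrt 3 := by
        rw [hq, show (12 : ℝ) = 2 ^ 2 * 3 by norm_num, Real.sqrt_mul (by norm_num),
          Real.sqrt_sq (by norm_num)]
      have h30 : 0 < Real.sqrt 3 := by positivity
      have h32 : Real.sqrt 3 ^ 2 = 3 := Real.sq_sqrt (by norm_num)
      rw [hs2, this]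
      field_simp
      rw [h32]; ring
    have h4 : E ^ 3 ≤ Real.exp (π / 2 * Real.sqrt (2 * n / 3)) := by
      rw [← hE3]
      apply Real.exp_le_exp.mpr
      have : s / 6 ≤ Real.sqrt (2 * n / 3) / 1 := by
        rw [div_one]
        apply Real.le_sqrt_of_sq_le
        rw [div_pow, hs2]; linarith
      rw [hμ]; nlinarith
    rw [h3, div_div_eq_mul_div]
    rw [mul_comm q]
    gcongr
  refine le_trans ?_ hRHS
  have h1 := abs_sub_le (Fintype.card (Nat.Partition n) : ℝ)
    (12 * q / (π * s ^ 3) * (μ * Real.sinh μ - Real.cosh μ)) (partitionMain n)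
  have h2 : Real.sqrt 2 * |12 * q / (π * s ^ 3) * (μ / 2 * Real.sinh (μ / 2) - Real.cosh (μ / 2))| ≤
      1.4143 * (q / s ^ 2 * (E ^ 3 / 2)) := by gcongr
  have h3 : (15 * (1 + Real.sqrt 2) + (0.26 * E + 1)) * E ≤ (37.3 + 0.26 * E) * E :=
    mul_le_mul_of_nonneg_right (by linarith) hE0.le
  have hs11990 : 11990 ≤ s ^ 2 := by rw [hs2]; linarith
  have hE3000 : 3000 ≤ E := by linarith
  have hfin := large_numeric_bound hq0 hs11990 hES hE3000
  rw [← hE] at key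
  linarith

lemma four_pow_mul_multichoose_half (n : ℕ) :
    4 ^ n * Ring.multichoose (1 / 2 : ℝ) n = Nat.centralBinom n := by
  have key : ∀ n : ℕ, (n.factorial : ℝ) * Ring.multichoose (1 / 2 : ℝ) n =
      (ascPochhammer ℝ n).eval (1 / 2) := fun n ↦ by
    have := Ring.factorial_nsmul_multichoose_eq_ascPochhammer (1 / 2 : ℝ) n
    rwa [Polynomial.ascPochhammer_smeval_eq_eval, nsmul_eq_mul] at this
  induction n with
  | zero => simp
  | succ n ih =>
    have h1 := key (n + 1)
    rw [ascPochhammer_succ_eval, ← key n, Nat.factorial_succ] at h1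
    have h2 : ((n : ℝ) + 1) * Nat.centralBinom (n + 1) = 2 * (2 * n + 1) * Nat.centralBinom n := by
      exact_mod_cast Nat.succ_mul_centralBinom_succ n
    have hf : (n.factorial : ℝ) ≠ 0 := by positivity
    have h3 : ((n : ℝ) + 1) * Ring.multichoose (1 / 2 : ℝ) (n + 1) =
        Ring.multichoose (1 / 2 : ℝ) n * (1 / 2 + n) := by
      apply mul_left_cancel₀ hf
      push_cast at h1
      linear_combination h1
    have hn : (n : ℝ) + 1 ≠ 0 := by positivity
    apply mul_left_cancel₀ hn
    rw [h2, ← ih, pow_succ]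
    linear_combination 4 ^ n * 4 * h3

lemma hasSum_centralBinom {z : ℝ} (hz : |z| < 1 / 4) :
    HasSum (fun k : ℕ ↦ (Nat.centralBinom k : ℝ) * z ^ k) (1 / Real.sqrt (1 - 4 * z)) := by
  have h := (Real.one_div_one_sub_rpow_hasFPowerSeriesOnBall_zero (1 / 2)).hasSum (y := 4 * z) (by
    rw [Metric.mem_eball, edist_zero_right, enorm_eq_nnnorm]
    have : ‖4 * z‖ < 1 := by rw [Real.norm_eq_abs, abs_mul]; norm_num; linarith
    exact_mod_cast this)
  rw [zero_add, ← Real.sqrt_eq_rpow] at h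
  convert! h using 2 with k
  rw [← four_pow_mul_multichoose_half, Ring.multichoose_eq]
  simp [FormalMultilinearSeries.ofScalars, mul_pow]
  ring

/-- `∑ₖ binom(2k+ℓ, k) zᵏ`. -/
noncomputable def ballotSum (z : ℝ) (l : ℕ) : ℝ := ∑' k : ℕ, ((2 * k + l).choose k : ℝ) * z ^ k

/-- `∑ₖ (k+ℓ) binom(2k+ℓ, k) zᵏ`. -/
noncomputable def weightedBallotSum (z : ℝ) (l : ℕ) : ℝ :=
  ∑' k : ℕ, ((k : ℝ) + l) * ((2 * k + l).choose k : ℝ) * z ^ k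

section
variable {z : ℝ}

lemma summable_weightedBallotSum (hz : 0 < z) (hz' : z < 1 / 4) (l : ℕ) :
    Summable fun k : ℕ ↦ ((k : ℝ) + l) * ((2 * k + l).choose k : ℝ) * z ^ k := by
  have h1 : Summable fun k : ℕ ↦ 2 ^ l * ((k : ℝ) ^ 1 * (4 * z) ^ k + l * (4 * z) ^ k) := by
    have hn : ‖4 * z‖ < 1 := by rw [Real.norm_of_nonneg (by linarith)]; linarith
    exact ((summable_pow_mul_geometric_of_norm_lt_one 1 hn).add
      ((summable_geometric_of_norm_lt_one hn).mul_left _)).mul_left _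
  refine h1.of_nonneg_of_le (fun k ↦ by positivity) fun k ↦ ?_
  have h2 : ((2 * k + l).choose k : ℝ) ≤ 2 ^ (2 * k + l) := by
    exact_mod_cast Nat.choose_le_two_pow _ _
  calc _ ≤ ((k : ℝ) + l) * 2 ^ (2 * k + l) * z ^ k := by gcongr
    _ = _ := by rw [pow_add, pow_mul, mul_pow]; norm_num; ring

lemma summable_ballotSum (hz : 0 < z) (hz' : z < 1 / 4) (l : ℕ) :
    Summable fun k : ℕ ↦ ((2 * k + l).choose k : ℝ) * z ^ k := by
  have h1 : Summable fun k : ℕ ↦ 2 ^ l * (4 * z) ^ k := by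
    have hn : ‖4 * z‖ < 1 := by rw [Real.norm_of_nonneg (by linarith)]; linarith
    exact (summable_geometric_of_norm_lt_one hn).mul_left _
  refine h1.of_nonneg_of_le (fun k ↦ by positivity) fun k ↦ ?_
  have h2 : ((2 * k + l).choose k : ℝ) ≤ 2 ^ (2 * k + l) := by
    exact_mod_cast Nat.choose_le_two_pow _ _
  calc _ ≤ 2 ^ (2 * k + l) * z ^ k := by gcongr
    _ = _ := by rw [pow_add, pow_mul, mul_pow]; norm_num; ring

lemma choose_pascal (k l : ℕ) : ((2 * (k + 1) + (l + 1)).choose (k + 1) : ℝ) =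
    ((2 * (k + 1) + l).choose (k + 1) : ℝ) + ((2 * k + (l + 2)).choose k : ℝ) := by
  rw [← add_assoc, Nat.choose_succ_succ, Nat.cast_add, add_comm,
    show 2 * (k + 1) + l = 2 * k + (l + 2) by ring]

lemma choose_central (k : ℕ) : ((2 * (k + 1) + 0).choose (k + 1) : ℝ) =
    2 * ((2 * k + 1).choose k : ℝ) := by
  rw [show 2 * (k + 1) + 0 = (2 * k + 1) + 1 by ring, Nat.choose_succ_succ,
    Nat.choose_symm_half]
  push_cast; ring

lemma ballotSum_zero (hz : 0 < z) (hz' : z < 1 / 4) :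
    ballotSum z 0 = 1 / Real.sqrt (1 - 4 * z) := by
  rw [← (hasSum_centralBinom (by rw [abs_of_pos hz]; exact hz')).tsum_eq]
  rfl

lemma ballotSum_zero_eq (hz : 0 < z) (hz' : z < 1 / 4) :
    ballotSum z 0 = 1 + 2 * z * ballotSum z 1 := by
  have h := (summable_ballotSum hz hz' 0).tsum_eq_zero_add
  rw [ballotSum, h, ballotSum, ← tsum_mul_left]
  congr 1
  · simp
  · refine tsum_congr fun k ↦ ?_
    rw [choose_central, pow_succ]; ring

lemma ballotSum_succ (hz : 0 < z) (hz' : z < 1 / 4) (l : ℕ) :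
    ballotSum z (l + 1) = ballotSum z l + z * ballotSum z (l + 2) := by
  have h := (summable_ballotSum hz hz' (l + 1)).tsum_eq_zero_add
  have h' := (summable_ballotSum hz hz' l).tsum_eq_zero_add
  have s1 := (summable_nat_add_iff (G := ℝ) 1).mpr (summable_ballotSum hz hz' l)
  have s2 := (summable_ballotSum hz hz' (l + 2)).mul_left z
  rw [ballotSum, h, ballotSum, h', ballotSum, ← tsum_mul_left, add_assoc, ← s1.tsum_add s2]
  congr 1
  · simp
  · refine tsum_congr fun k ↦ ?_
    rw [choose_pascal, pow_succ]; ring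

lemma weightedBallotSum_succ (hz : 0 < z) (hz' : z < 1 / 4) (l : ℕ) :
    weightedBallotSum z (l + 1) =
      weightedBallotSum z l + ballotSum z l + z * weightedBallotSum z (l + 2) := by
  have h := (summable_weightedBallotSum hz hz' (l + 1)).tsum_eq_zero_add
  have h' := ((summable_weightedBallotSum hz hz' l).add
    (summable_ballotSum hz hz' l)).tsum_eq_zero_add
  have s1 := (summable_nat_add_iff (G := ℝ) 1).mpr ((summable_weightedBallotSum hz hz' l).add
    (summable_ballotSum hz hz' l))
  have s2 := (summable_weightedBallotSum hz hz' (l + 2)).mul_left z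
  rw [weightedBallotSum, h, weightedBallotSum, ballotSum,
    ← (summable_weightedBallotSum hz hz' l).tsum_add (summable_ballotSum hz hz' l), h',
    weightedBallotSum, ← tsum_mul_left, add_assoc, ← s1.tsum_add s2]
  congr 1
  · simp
  · refine tsum_congr fun k ↦ ?_
    rw [choose_pascal, pow_succ]; push_cast; ring

lemma weightedBallotSum_zero_eq (hz : 0 < z) (hz' : z < 1 / 4) :
    weightedBallotSum z 0 = 2 * z * weightedBallotSum z 1 := by
  have h := (summable_weightedBallotSum hz hz' 0).tsum_eq_zero_add
  rw [weightedBallotSum, h, weightedBallotSum, ← tsum_mul_left]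
  simp only [Nat.cast_zero, add_zero, zero_mul, zero_add]
  refine tsum_congr fun k ↦ ?_
  rw [← add_zero (2 * (k + 1)), choose_central, pow_succ]; push_cast; ring

lemma weightedBallotSum_zero_eq' (hz : 0 < z) (hz' : z < 1 / 4) :
    weightedBallotSum z 0 = 2 * z * (2 * weightedBallotSum z 0 + ballotSum z 0) := by
  have h := (summable_weightedBallotSum hz hz' 0).tsum_eq_zero_add
  have s1 := (summable_weightedBallotSum hz hz' 0).mul_left 2
  conv_lhs => rw [weightedBallotSum, h]
  rw [weightedBallotSum, ballotSum, ← tsum_mul_left,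
    ← s1.tsum_add (summable_ballotSum hz hz' 0), ← tsum_mul_left]
  simp only [Nat.cast_zero, add_zero, zero_mul, zero_add]
  refine tsum_congr fun k ↦ ?_
  have h2 : ((k : ℝ) + 1) * Nat.centralBinom (k + 1) = 2 * (2 * k + 1) * Nat.centralBinom k := by
    exact_mod_cast Nat.succ_mul_centralBinom_succ k
  rw [Nat.centralBinom, Nat.centralBinom] at h2
  push_cast
  rw [h2, pow_succ]; ring

lemma ballotSum_eq (hz : 0 < z) (hz' : z < 1 / 4) {D : ℝ} (hD : D = Real.sqrt (1 - 4 * z)) (l : ℕ) :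
    ballotSum z l = ((1 - D) / (2 * z)) ^ l / D := by
  have hD0 : 0 < D := by rw [hD]; apply Real.sqrt_pos.mpr; linarith
  have hD2 : D ^ 2 = 1 - 4 * z := by rw [hD]; apply Real.sq_sqrt; linarith
  induction l using Nat.twoStepInduction with
  | zero => rw [ballotSum_zero hz hz', ← hD]; simp
  | one =>
    have h1 := ballotSum_zero_eq hz hz'
    rw [ballotSum_zero hz hz', ← hD] at h1
    field_simp at h1 ⊢
    linarith
  | more l h0 h1 =>
    have h := ballotSum_succ hz hz' l
    have : ballotSum z (l + 2) = (ballotSum z (l + 1) - ballotSum z l) / z := by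
      rw [h]; field_simp; ring
    rw [this, h0, h1, pow_succ, pow_succ _ (l + 1), pow_succ]
    generalize ((1 - D) / (2 * z)) ^ l = w
    field_simp
    linear_combination (-w) * hD2

lemma weightedBallotSum_eq (hz : 0 < z) (hz' : z < 1 / 4) {D : ℝ} (hD : D = Real.sqrt (1 - 4 * z))
    (l : ℕ) : weightedBallotSum z l =
      ((1 - D) / (2 * z)) ^ l * (2 * z / (1 - D)) * ((l - 1) / D ^ 2 + 1 / D ^ 3) := by
  have hD0 : 0 < D := by rw [hD]; apply Real.sqrt_pos.mpr; linarith
  have hD2 : D ^ 2 = 1 - 4 * z := by rw [hD]; apply Real.sq_sqrt; linarith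
  have hD1 : 1 - D ≠ 0 := by
    have : D < 1 := by nlinarith
    linarith
  have h0 : weightedBallotSum z 0 = 2 * z / D ^ 3 := by
    have h := weightedBallotSum_zero_eq' hz hz'
    rw [ballotSum_zero hz hz', ← hD] at h
    have : D ^ 2 * weightedBallotSum z 0 = 2 * z / D := by
      rw [hD2]; linear_combination h
    field_simp
    field_simp at this
    linear_combination this
  induction l using Nat.twoStepInduction with
  | zero =>
    rw [h0]; field_simp; push_cast; ring
  | one =>
    have h1 := weightedBallotSum_zero_eq hz hz'
    rw [h0] at h1
    field_simp at h1 ⊢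
    push_cast
    linear_combination -h1
  | more l h0 h1 =>
    have h := weightedBallotSum_succ hz hz' l
    have : weightedBallotSum z (l + 2) =
        (weightedBallotSum z (l + 1) - weightedBallotSum z l - ballotSum z l) / z := by
      rw [h]; field_simp; ring
    rw [this, h0, h1, ballotSum_eq hz hz' hD, pow_add _ l 1, pow_add _ l 2]
    generalize ((1 - D) / (2 * z)) ^ l = w
    push_cast
    have hz4 : z = (1 - D ^ 2) / 4 := by linarith
    have h1D : 1 + D ≠ 0 := by linarith
    have hz5 : z = (1 - D) * (1 + D) / 4 := by rw [hz4]; ring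
    rw [hz5]
    field_simp
    ring

end

/-- The inner sums `∑ₖ binom(m+1,k) (m+1-k)/(m+1-2k)! a^(m-2k)`. -/
noncomputable def innerSum (a : ℝ) (m : ℕ) : ℝ :=
  ∑ k ∈ Finset.range ((m + 1) / 2 + 1),
      ((m + 1).choose k : ℝ) * ((m + 1 - k : ℕ) : ℝ) / ((m + 1 - 2 * k).factorial : ℝ) *
        a ^ ((m : ℤ) - 2 * k)

/-- The summand of the double series behind the expansion. -/
noncomputable def doubleTerm (a y : ℝ) (q : ℕ × ℕ) : ℝ :=
  (a * y) ^ q.1 / q.1.factorial *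
    (((q.2 : ℝ) + q.1) * ((2 * q.2 + q.1).choose q.2 : ℝ) * (y ^ 2) ^ q.2)

lemma hasSum_exp_linear (u A B : ℝ) :
    HasSum (fun l : ℕ ↦ u ^ l / l.factorial * (l * A + B)) (Real.exp u * (u * A + B)) := by
  have h : HasSum (fun l : ℕ ↦ u ^ l / l.factorial) (Real.exp u) := by
    rw [Real.exp_eq_exp_ℝ]
    exact NormedSpace.expSeries_div_hasSum_exp u
  have h1 : HasSum (fun l : ℕ ↦ u ^ l / l.factorial * l) (u * Real.exp u) := by
    rw [← hasSum_nat_add_iff' 1]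
    simp only [range_one, sum_singleton, Nat.cast_zero, mul_zero, sub_zero]
    convert! h.mul_left u using 2 with l
    rw [Nat.factorial_succ]; push_cast
    have : (l.factorial : ℝ) ≠ 0 := by positivity
    field_simp
    ring
  have h2 := (h1.mul_right A).add (h.mul_right B)
  convert! h2 using 1
  · funext l; ring
  · ring

section
variable {y D : ℝ}

lemma hasSum_doubleTerm_row (hy : 0 < y) (hy' : y < 1 / 2) (hD : D = Real.sqrt (1 - 4 * y ^ 2))
    (a : ℝ) (l : ℕ) : HasSum (fun k ↦ doubleTerm a y (l, k))
      ((a * ((1 - D) / (2 * y))) ^ l / l.factorial *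
        (l * (2 * y ^ 2 / (1 - D) / D ^ 2) + 2 * y ^ 2 / (1 - D) * (1 / D ^ 3 - 1 / D ^ 2))) := by
  have hz : 0 < y ^ 2 := by positivity
  have hz' : y ^ 2 < 1 / 4 := by nlinarith
  have h := (summable_weightedBallotSum hz hz' l).hasSum.mul_left ((a * y) ^ l / l.factorial)
  rw [← weightedBallotSum, weightedBallotSum_eq hz hz' hD] at h
  convert! h using 1
  have : a * ((1 - D) / (2 * y)) = a * y * ((1 - D) / (2 * y ^ 2)) := by field_simp
  rw [this, mul_pow _ ((1 - D) / (2 * y ^ 2))]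
  ring

lemma summable_doubleTerm (hy : 0 < y) (hy' : y < 1 / 2) (a : ℝ) : Summable (doubleTerm a y) := by
  have key : Summable (doubleTerm |a| y) := by
    refine (summable_prod_of_nonneg fun q ↦ ?_).mpr
      ⟨fun l ↦ (hasSum_doubleTerm_row hy hy' rfl |a| l).summable, ?_⟩
    · unfold doubleTerm
      simp only [Pi.zero_apply]
      positivity
    · simp_rw [fun l ↦ (hasSum_doubleTerm_row hy hy' rfl |a| l).tsum_eq]
      exact (hasSum_exp_linear _ _ _).summable
  refine key.of_norm_bounded fun q ↦ le_of_eq ?_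
  unfold doubleTerm
  rw [norm_mul, norm_div, norm_pow, norm_mul, Real.norm_eq_abs a, Real.norm_of_nonneg hy.le,
    Real.norm_of_nonneg (by positivity : 0 ≤ (q.1.factorial : ℝ)),
        Real.norm_of_nonneg (by positivity)]

lemma hasSum_doubleTerm (hy : 0 < y) (hy' : y < 1 / 2) (hD : D = Real.sqrt (1 - 4 * y ^ 2))
    (a : ℝ) : HasSum (doubleTerm a y) (Real.exp (a * ((1 - D) / (2 * y))) *
      (a * y / D ^ 2 + 2 * y ^ 2 / (1 - D) * (1 / D ^ 3 - 1 / D ^ 2))) := by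
  have hD1 : 1 - D ≠ 0 := by
    have : D < 1 := by rw [hD, Real.sqrt_lt' one_pos]; nlinarith
    linarith
  have h := (summable_doubleTerm hy hy' a).hasSum.prod_fiberwise
    fun l ↦ hasSum_doubleTerm_row hy hy' hD a l
  have h' := hasSum_exp_linear (a * ((1 - D) / (2 * y))) (2 * y ^ 2 / (1 - D) / D ^ 2)
    (2 * y ^ 2 / (1 - D) * (1 / D ^ 3 - 1 / D ^ 2))
  have e := h.unique h'
  have := (summable_doubleTerm hy hy' a).hasSum
  rw [e] at this
  convert! this using 3
  field_simp

lemma hasSum_doubleTerm_diag (hy : 0 < y) (hy' : y < 1 / 2) (hD : D = Real.sqrt (1 - 4 * y ^ 2))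
    (a : ℝ) : HasSum (fun m ↦ ∑ k ∈ range (m / 2 + 1), doubleTerm a y (m - 2 * k, k))
    (Real.exp (a * ((1 - D) / (2 * y))) *
      (a * y / D ^ 2 + 2 * y ^ 2 / (1 - D) * (1 / D ^ 3 - 1 / D ^ 2))) := by
  have h := hasSum_doubleTerm hy hy' hD a
  let e : ℕ × ℕ → ℕ × ℕ := fun q ↦ (q.1 + 2 * q.2, q.2)
  let g : ℕ × ℕ → ℝ := fun q ↦ if 2 * q.2 ≤ q.1 then doubleTerm a y (q.1 - 2 * q.2, q.2) else 0
  have he : Function.Injective e := by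
    rintro ⟨l, k⟩ ⟨l', k'⟩ h
    simp only [e, Prod.mk.injEq] at h ⊢
    omega
  have hg : g ∘ e = doubleTerm a y := by
    funext ⟨l, k⟩
    simp [g, e]
  rw [← hg, he.hasSum_iff] at h
  · refine h.prod_fiberwise fun m ↦ ?_
    have : ∑ k ∈ range (m / 2 + 1), doubleTerm a y (m - 2 * k, k) =
        ∑ k ∈ range (m / 2 + 1), g (m, k) := by
      refine sum_congr rfl fun k hk ↦ ?_
      rw [mem_range] at hk
      simp only [g]
      rw [if_pos (by omega)]
    rw [this]
    refine hasSum_sum_of_ne_finset_zero fun k hk ↦ ?_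
    rw [mem_range] at hk
    simp only [g]
    rw [if_neg (by omega)]
  · rintro ⟨m, k⟩ hq
    simp only [g]
    rw [if_neg]
    intro hle
    exact hq ⟨(m - 2 * k, k), by simp only [e, Prod.mk.injEq, and_true]; omega⟩

lemma sum_doubleTerm_succ {a : ℝ} (ha : a ≠ 0) (m : ℕ) :
    ∑ k ∈ range ((m + 1) / 2 + 1), doubleTerm a y (m + 1 - 2 * k, k) =
      a * y * (y ^ m * innerSum a m) := by
  rw [innerSum, mul_sum, mul_sum]
  refine sum_congr rfl fun k hk ↦ ?_
  rw [mem_range] at hk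
  obtain ⟨l, hl⟩ : ∃ l, m + 1 = l + 2 * k := ⟨m + 1 - 2 * k, by omega⟩
  have e1 : (m : ℤ) - 2 * k = l - 1 := by omega
  rw [doubleTerm, e1, hl, show l + 2 * k - 2 * k = l by omega,
    show l + 2 * k - k = k + l by omega, add_comm l, zpow_sub_one₀ ha, zpow_natCast]
  have e2 : y ^ (2 * k + l) = y ^ m * y := by rw [← pow_succ, hl, add_comm]
  have e3 : y ^ l * (y ^ 2) ^ k = y ^ m * y := by rw [← e2, pow_add, pow_mul]; ring
  push_cast
  rw [mul_pow]
  have : (l.factorial : ℝ) ≠ 0 := by positivity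
  field_simp
  linear_combination ((2 * k + l).choose k : ℝ) * ((k : ℝ) + l) * e3

end

lemma innerSum_neg (a : ℝ) (m : ℕ) : innerSum (-a) m = (-1) ^ m * innerSum a m := by
  rw [innerSum, innerSum, mul_sum]
  refine sum_congr rfl fun k hk ↦ ?_
  have : (-a) ^ ((m : ℤ) - 2 * k) = (-1) ^ m * a ^ ((m : ℤ) - 2 * k) := by
    rw [neg_eq_neg_one_mul, mul_zpow, zpow_sub₀ (by norm_num), zpow_mul]
    norm_num
  rw [this]; ring

/-- The convergent expansion of the main term. -/
lemma hasSum_innerSum {a x D : ℝ} (ha : 0 < a) (hx : 0 < x) (hx' : x < 1)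
    (hD : D = Real.sqrt (1 - x ^ 2)) :
    HasSum (fun m : ℕ ↦ (-1) ^ m * ((x / 2) ^ m * innerSum a m))
      (1 / D ^ 2 * (1 - x / (a * D)) * Real.exp (-(a / x * (1 - D)))) := by
  have hD' : D = Real.sqrt (1 - 4 * (x / 2) ^ 2) := by rw [hD]; ring_nf
  have hD0 : 0 < D := by rw [hD]; apply Real.sqrt_pos.mpr; nlinarith
  have hD1 : 1 - D ≠ 0 := by
    have : D < 1 := by rw [hD, Real.sqrt_lt' one_pos]; nlinarith
    linarith
  have h := hasSum_doubleTerm_diag (by positivity) (by linarith) hD' (-a)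
  rw [← hasSum_nat_add_iff' 1] at h
  have h0 : ∑ m ∈ range 1, ∑ k ∈ range (m / 2 + 1), doubleTerm (-a) (x / 2) (m - 2 * k, k) = 0 := by
    simp [doubleTerm]
  rw [h0, sub_zero] at h
  simp_rw [sum_doubleTerm_succ (neg_ne_zero.mpr ha.ne')] at h
  have h2 := h.mul_left (1 / (-a * (x / 2)))
  convert! h2 using 1
  · funext m
    rw [innerSum_neg]
    field_simp
  · rw [show -a * ((1 - D) / (2 * (x / 2))) = -(a / x * (1 - D)) by field_simp]
    generalize Real.exp (-(a / x * (1 - D))) = w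
    have hne : a * D ≠ 0 := by positivity
    field_simp
    ring

lemma innerSum_pos {a : ℝ} (ha : 0 < a) (m : ℕ) : 0 < innerSum a m := by
  refine sum_pos (fun k hk ↦ ?_) (by simp)
  rw [mem_range] at hk
  have h1 : 0 < (m + 1).choose k := Nat.choose_pos (by omega)
  have h2 : 0 < m + 1 - k := by omega
  have := Nat.factorial_pos (m + 1 - 2 * k)
  positivity

lemma innerSum_succ_le {a : ℝ} (ha : 1 / 2 < a) (ha' : a < 0.53) (m : ℕ) :
    innerSum a (m + 1) ≤ 6.2 * innerSum a m := by
  have ha0 : 0 < a := by linarith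
  set u : ℕ → ℕ → ℝ := fun m k ↦ ((m + 1).choose k : ℝ) * ((m + 1 - k : ℕ) : ℝ) /
    ((m + 1 - 2 * k).factorial : ℝ) * a ^ ((m : ℤ) - 2 * k) with hu
  have hI : ∀ m, innerSum a m = ∑ k ∈ range ((m + 1) / 2 + 1), u m k := fun m ↦ rfl
  have hu0 : ∀ m k, 0 ≤ u m k := fun m k ↦ by simp only [hu]; positivity
  have h1 : ∀ k ∈ range ((m + 1) / 2 + 1), u (m + 1) k ≤ 2.2 * u m k := by
    intro k hk
    rw [mem_range] at hk
    obtain ⟨l, hl⟩ : ∃ l, m + 1 = l + 2 * k := ⟨m + 1 - 2 * k, by omega⟩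
    have e1 : (m : ℤ) - 2 * k = l - 1 := by omega
    have e2 : ((m + 1 : ℕ) : ℤ) - 2 * k = l := by omega
    have e3 : (((m + 1) + 1).choose k : ℝ) * (l + k + 1) = ((m + 1).choose k : ℝ) *
        (l + 2 * k + 1) := by
      have := Nat.choose_mul_succ_eq (m + 1) k
      rw [show m + 1 + 1 - k = l + k + 1 by omega] at this
      have h := congrArg (Nat.cast (R := ℝ)) this
      push_cast at h
      have hl' : (m : ℝ) + 1 = l + 2 * k := by exact_mod_cast hl
      rw [hl'] at h
      linarith
    simp only [hu]
    rw [e1, e2, show m + 1 + 1 - k = l + k + 1 by omega, show m + 1 - k = l + k by omega,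
      show m + 1 + 1 - 2 * k = l + 1 by omega, show m + 1 - 2 * k = l by omega,
      Nat.factorial_succ, zpow_sub_one₀ ha0.ne', zpow_natCast]
    push_cast
    rw [e3]
    have hkey : ((l : ℝ) + 2 * k + 1) * a ≤ 2.2 * ((l + k) * (l + 1)) := by
      have hk0 : (0 : ℝ) ≤ k := by positivity
      rcases Nat.eq_zero_or_pos l with h | h
      · have : (1 : ℝ) ≤ k := by exact_mod_cast (by omega : 1 ≤ k)
        rw [h]; push_cast; nlinarith
      · have : (1 : ℝ) ≤ l := by exact_mod_cast h
        nlinarith [mul_nonneg hk0 (by linarith : (0 : ℝ) ≤ l - 1)]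
    have hf : (0 : ℝ) < l.factorial := by positivity
    have hc : (0 : ℝ) ≤ (m + 1).choose k := by positivity
    have hl1 : (0 : ℝ) < l + 1 := by positivity
    have : ((m + 1).choose k : ℝ) * (l + 2 * k + 1) / ((l + 1) * l.factorial) * a ^ l =
        ((m + 1).choose k : ℝ) * (a ^ l / a) / l.factorial * ((l + 2 * k + 1) * a / (l + 1)) := by
      field_simp
    rw [this]
    have h2 : ((l : ℝ) + 2 * k + 1) * a / (l + 1) ≤ 2.2 * (l + k) := by
      rw [div_le_iff₀ hl1]; linarith
    calc _ ≤ ((m + 1).choose k : ℝ) * (a ^ l / a) / l.factorial * (2.2 * (l + k)) := by gcongr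
      _ = _ := by ring
  have h2 : ∑ k ∈ range ((m + 1) / 2 + 1), u (m + 1) k ≤ 2.2 * innerSum a m := by
    rw [hI, mul_sum]
    exact sum_le_sum h1
  rcases Nat.even_or_odd' m with ⟨j, rfl | rfl⟩
  · rw [hI, show (2 * j + 1 + 1) / 2 + 1 = (2 * j + 1) / 2 + 1 + 1 by omega, sum_range_succ]
    have h3 : u (2 * j + 1) ((2 * j + 1) / 2 + 1) ≤ 4 * u (2 * j) j := by
      rw [show (2 * j + 1) / 2 + 1 = j + 1 by omega]
      simp only [hu]
      rw [show 2 * j + 1 + 1 - (j + 1) = j + 1 by omega,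
        show 2 * j + 1 + 1 - 2 * (j + 1) = 0 by omega, show 2 * j + 1 - j = j + 1 by omega,
        show 2 * j + 1 - 2 * j = 1 by omega, Nat.choose_succ_succ, Nat.choose_symm_half]
      have e1 : ((2 * j + 1 : ℕ) : ℤ) - 2 * ((j + 1 : ℕ) : ℤ) = -1 := by push_cast; ring
      have e2 : ((2 * j : ℕ) : ℤ) - 2 * (j : ℤ) = 0 := by push_cast; ring
      rw [e1, e2]
      simp only [Nat.factorial, zpow_neg, zpow_one, zpow_zero]
      have hai : a⁻¹ ≤ 2 := by
        rw [inv_le_comm₀ ha0 (by norm_num)]; linarith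
      have : (0 : ℝ) ≤ ((2 * j + 1).choose j : ℝ) * (j + 1) := by positivity
      push_cast
      nlinarith
    have h4 : u (2 * j) j ≤ innerSum a (2 * j) := by
      rw [hI]
      exact single_le_sum (f := u (2 * j)) (fun k _ ↦ hu0 _ _) (by rw [mem_range]; omega)
    linarith
  · have := innerSum_pos ha0 (2 * j + 1)
    rw [hI, show (2 * j + 1 + 1 + 1) / 2 + 1 = (2 * j + 1 + 1) / 2 + 1 by omega]
    linarith

lemma centralBinom_sq_mul_le (n : ℕ) :
    (Nat.centralBinom n : ℝ) ^ 2 / 16 ^ n * (n + 1 / 4) ≤ 1 / π := by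
  set d : ℕ → ℝ := fun n ↦ (Nat.centralBinom n : ℝ) ^ 2 / 16 ^ n * (n + 1 / 4) with hd
  have hmono : Monotone d := by
    refine monotone_nat_of_le_succ fun n ↦ ?_
    have h2 : ((n : ℝ) + 1) * Nat.centralBinom (n + 1) = 2 * (2 * n + 1) * Nat.centralBinom n := by
      exact_mod_cast Nat.succ_mul_centralBinom_succ n
    have h3 : (Nat.centralBinom (n + 1) : ℝ) = 2 * (2 * n + 1) * Nat.centralBinom n / (n + 1) := by
      field_simp; linarith
    simp only [hd]
    rw [h3, pow_succ (16 : ℝ), div_mul_eq_mul_div, div_mul_eq_mul_div,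
        div_le_div_iff₀ (by positivity)
      (by positivity)]
    push_cast
    have hn : (0 : ℝ) < n + 1 := by positivity
    rw [div_pow, div_mul_eq_mul_div, div_mul_eq_mul_div, le_div_iff₀ (by positivity)]
    have : (0 : ℝ) ≤ (Nat.centralBinom n : ℝ) ^ 2 * 16 ^ n := by positivity
    have hp : (n + 1 / 4) * 16 * (n + 1) ^ 2 ≤ (2 * (2 * (n : ℝ) + 1)) ^ 2 * (n + 1 + 1 / 4) := by
      nlinarith
    linarith [mul_le_mul_of_nonneg_left hp this]
  have hW : ∀ n : ℕ, d n = (n + 1 / 4) / (2 * n + 1) / Real.Wallis.W n := by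
    intro n
    rw [Real.Wallis.W_eq_factorial_ratio]
    have h : ((2 * n).factorial : ℝ) = Nat.centralBinom n * n.factorial * n.factorial := by
      have := Nat.choose_mul_factorial_mul_factorial (show n ≤ 2 * n by omega)
      rw [show 2 * n - n = n by omega] at this
      exact_mod_cast this.symm
    have hf : (n.factorial : ℝ) ≠ 0 := by positivity
    have hc : (Nat.centralBinom n : ℝ) ≠ 0 := by
      exact_mod_cast Nat.centralBinom_ne_zero n
    have h16 : (2 : ℝ) ^ (4 * n) = 16 ^ n := by rw [pow_mul]; norm_num
    simp only [hd]
    rw [h, h16]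
    field_simp
  have hlim : Tendsto d atTop (𝓝 (1 / 2 / (π / 2))) := by
    have : d = fun n : ℕ ↦ ((n : ℝ) + 1 / 4) / (2 * n + 1) / Real.Wallis.W n := funext hW
    rw [this]
    refine Tendsto.div ?_ Real.Wallis.tendsto_W_nhds_pi_div_two (by positivity)
    have h : Tendsto (fun n : ℕ ↦ (1 : ℝ) / 2 - 1 / 8 / (n + 1 / 2)) atTop (𝓝 (1 / 2 - 0)) := by
      refine tendsto_const_nhds.sub (Tendsto.div_atTop tendsto_const_nhds ?_)
      exact tendsto_atTop_add_const_right _ _ tendsto_natCast_atTop_atTop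
    rw [sub_zero] at h
    refine h.congr fun n ↦ ?_
    have : (2 * (n : ℝ) + 1) ≠ 0 := by positivity
    have : ((n : ℝ) + 1 / 2) ≠ 0 := by positivity
    field_simp
    ring
  have := hmono.ge_of_tendsto hlim n
  calc _ ≤ _ := this
    _ = _ := by field_simp

lemma innerSum_even_le {a : ℝ} (ha : 0 < a) (N : ℕ) :
    innerSum a (2 * N) ≤ (2 * N + 1) * Nat.centralBinom N * (Real.sinh a / a) := by
  have h1 : innerSum a (2 * N) = ∑ i ∈ range (N + 1),
      (2 * N + 1) * ((2 * N).choose (N - i) : ℝ) * (a ^ (2 * i) / (2 * i + 1).factorial) := by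
    rw [innerSum, show (2 * N + 1) / 2 + 1 = N + 1 by omega, ← sum_range_reflect]
    refine sum_congr rfl fun i hi ↦ ?_
    rw [mem_range] at hi
    obtain ⟨k, rfl⟩ : ∃ k, N = i + k := ⟨N - i, by omega⟩
    have e1 : (((2 * (i + k) : ℕ)) : ℤ) - 2 * (k : ℤ) = ((2 * i : ℕ) : ℤ) := by push_cast; ring
    have e2 := Nat.choose_mul_succ_eq (2 * (i + k)) k
    have e3 := congrArg (Nat.cast (R := ℝ)) e2
    rw [show i + k + 1 - 1 - i = k by omega, show i + k - i = k by omega, e1, zpow_natCast,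
      show 2 * (i + k) + 1 - 2 * k = 2 * i + 1 by omega]
    push_cast at e3 ⊢
    rw [← e3]
    ring
  rw [h1]
  have h2 : HasSum (fun i : ℕ ↦ a ^ (2 * i) / (2 * i + 1).factorial) (Real.sinh a / a) := by
    have := (Real.hasSum_sinh a).mul_right (1 / a)
    convert! this using 1
    · funext i
      rw [pow_succ]
      field_simp
    · ring
  calc _ ≤ ∑ i ∈ range (N + 1), (2 * N + 1) * (Nat.centralBinom N : ℝ) *
        (a ^ (2 * i) / (2 * i + 1).factorial) := by
        refine sum_le_sum fun i _ ↦ ?_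
        have : ((2 * N).choose (N - i) : ℝ) ≤ Nat.centralBinom N := by
          exact_mod_cast Nat.choose_le_centralBinom _ _
        gcongr
    _ ≤ _ := by
        rw [← mul_sum]
        refine mul_le_mul_of_nonneg_left ?_ (by positivity)
        exact sum_le_hasSum _ (fun i _ ↦ by positivity) h2

lemma half_pow_mul_innerSum_le (N : ℕ) : (1 / 2) ^ (2 * N) * innerSum (π / 6) (2 * N) ≤
    6 * Real.sqrt 2 / π ^ ((3 : ℝ) / 2) * Real.sinh (π / 6) * Real.sqrt (1 + 1 / (4 * N + 1)) *
      Real.sqrt (2 * N + 1) := by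
  have hpi := Real.pi_pos
  have h := innerSum_even_le (a := π / 6) (by positivity) N
  have hs : 0 ≤ Real.sinh (π / 6) := (Real.sinh_pos_iff.mpr (by positivity)).le
  have hN : (0 : ℝ) ≤ N := by positivity
  have hc : (Nat.centralBinom N : ℝ) / 4 ^ N ≤ 2 / Real.sqrt (π * (4 * N + 1)) := by
    have h1 := centralBinom_sq_mul_le N
    rw [le_div_iff₀ (by positivity)]
    have h2 : (Nat.centralBinom N : ℝ) / 4 ^ N * Real.sqrt (π * (4 * N + 1)) =
        Real.sqrt (((Nat.centralBinom N : ℝ) / 4 ^ N) ^ 2 * (π * (4 * N + 1))) := by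
      rw [Real.sqrt_mul (sq_nonneg _), Real.sqrt_sq (by positivity)]
    rw [h2]
    apply Real.sqrt_le_iff.mpr ⟨by norm_num, ?_⟩
    rw [div_pow, ← pow_mul, mul_comm N 2, pow_mul]
    rw [le_div_iff₀ hpi] at h1
    norm_num at h1 ⊢
    linarith
  have h4 : (1 / 2 : ℝ) ^ (2 * N) = 1 / 4 ^ N := by
    rw [pow_mul, ← one_div_pow]; norm_num
  have hpi32 : π ^ ((3 : ℝ) / 2) = π * Real.sqrt π := by
    rw [show (3 : ℝ) / 2 = 1 + 1 / 2 by norm_num, Real.rpow_add hpi, Real.rpow_one,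
      Real.sqrt_eq_rpow]
  have hsq : Real.sqrt (1 + 1 / (4 * N + 1)) =
      Real.sqrt 2 * Real.sqrt (2 * N + 1) / Real.sqrt (4 * N + 1) := by
    rw [← Real.sqrt_mul (by norm_num), ← Real.sqrt_div (by positivity)]
    congr 1; field_simp; ring
  have h2 : Real.sqrt 2 ^ 2 = 2 := Real.sq_sqrt (by norm_num)
  have h21 : Real.sqrt (2 * N + 1) ^ 2 = 2 * N + 1 := Real.sq_sqrt (by positivity)
  calc _ ≤ 1 / 4 ^ N * ((2 * N + 1) * Nat.centralBinom N * (Real.sinh (π / 6) / (π / 6))) := by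
        rw [h4]; gcongr
    _ = (2 * N + 1) * (Real.sinh (π / 6) / (π / 6)) * (Nat.centralBinom N / 4 ^ N) := by ring
    _ ≤ (2 * N + 1) * (Real.sinh (π / 6) / (π / 6)) * (2 / Real.sqrt (π * (4 * N + 1))) := by
        gcongr
    _ = _ := by
        rw [hpi32, hsq, Real.sqrt_mul hpi.le]
        have e1 : 0 < Real.sqrt π := by positivity
        have e2 : 0 < Real.sqrt (4 * N + 1) := by positivity
        field_simp
        rw [h2, h21]

/-- Application that makes kernel reduction evaluate the argument first. -/
def applyNat {α : Type} (q : ℕ) (f : ℕ → α) : α :=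
  match q with
  | 0 => f 0
  | k + 1 => f (k + 1)

lemma applyNat_eq {α : Type} (q : ℕ) (f : ℕ → α) : applyNat q f = f q := by
  cases q <;> rfl

/-- Horner scheme for the exponential series, rounded down. -/
def hornerDown (S t : ℕ) : ℕ → ℕ → ℕ
  | 0, v => v
  | k + 1, v => hornerDown S t k (S + t * v / (S * (k + 1)))

/-- Horner scheme for the exponential series, rounded up. -/
def hornerUp (S t : ℕ) : ℕ → ℕ → ℕ
  | 0, v => v
  | k + 1, v => hornerUp S t k (S + (t * v / (S * (k + 1)) + 1))

/-- Repeated squaring, rounded down. -/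
def squareDown (S : ℕ) : ℕ → ℕ → ℕ
  | 0, v => v
  | k + 1, v => applyNat v fun w ↦ squareDown S k (w * w / S)

/-- Repeated squaring, rounded up. -/
def squareUp (S : ℕ) : ℕ → ℕ → ℕ
  | 0, v => v
  | k + 1, v => applyNat v fun w ↦ squareUp S k (w * w / S + 1)

/-- Newton iteration for the square root of `N`. -/
def newtonSqrt (N : ℕ) : ℕ → ℕ → ℕ
  | 0, v => v
  | k + 1, v => applyNat v fun w ↦ newtonSqrt N k ((w + N / w) / 2)

/-- The real Horner scheme for the exponential series. -/
noncomputable def hornerReal (t : ℝ) : ℕ → ℝ → ℝ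
  | 0, v => v
  | k + 1, v => hornerReal t k (1 + t / (k + 1) * v)

lemma hornerReal_eq (t : ℝ) (k : ℕ) (v : ℝ) : hornerReal t k v =
    ∑ m ∈ range k, t ^ m / m.factorial + v * (t ^ k / k.factorial) := by
  induction k generalizing v with
  | zero => simp [hornerReal]
  | succ k ih =>
    rw [hornerReal, ih, sum_range_succ, Nat.factorial_succ]
    have : (k.factorial : ℝ) ≠ 0 := by positivity
    push_cast
    field_simp
    ring

lemma hornerReal_mono {t : ℝ} (ht : 0 ≤ t) (k : ℕ) {v w : ℝ} (h : v ≤ w) :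
    hornerReal t k v ≤ hornerReal t k w := by
  rw [hornerReal_eq, hornerReal_eq]; gcongr

lemma hornerDown_le {S : ℕ} (hS : 0 < S) (t k v : ℕ) :
    (hornerDown S t k v : ℝ) / S ≤ hornerReal ((t : ℝ) / S) k ((v : ℝ) / S) := by
  induction k generalizing v with
  | zero => rfl
  | succ k ih =>
    rw [hornerDown, hornerReal]
    refine (ih _).trans (hornerReal_mono (by positivity) k ?_)
    have h : ((t * v / (S * (k + 1)) : ℕ) : ℝ) ≤ (t * v : ℝ) / (S * (k + 1)) := by
      have := Nat.cast_div_le (α := ℝ) (m := t * v) (n := S * (k + 1))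
      push_cast at this ⊢
      exact this
    rw [Nat.cast_add]
    have hS : (0 : ℝ) < S := by exact_mod_cast hS
    generalize ((t * v / (S * (k + 1)) : ℕ) : ℝ) = d at h ⊢
    rw [add_div, div_self hS.ne']
    calc 1 + d / S ≤ 1 + (t * v : ℝ) / (S * (k + 1)) / S := by gcongr
      _ = _ := by field_simp

lemma le_hornerUp {S : ℕ} (hS : 0 < S) (t k v : ℕ) :
    hornerReal ((t : ℝ) / S) k ((v : ℝ) / S) ≤ (hornerUp S t k v : ℝ) / S := by
  induction k generalizing v with
  | zero => rfl
  | succ k ih =>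
    rw [hornerUp, hornerReal]
    refine (hornerReal_mono (by positivity) k ?_).trans (ih _)
    have h : (t * v : ℝ) / (S * (k + 1)) ≤ ((t * v / (S * (k + 1)) + 1 : ℕ) : ℝ) := by
      have := (Nat.lt_floor_add_one ((t * v : ℝ) / (S * (k + 1)))).le
      have e := Nat.floor_div_eq_div (K := ℝ) (t * v) (S * (k + 1))
      push_cast at e this ⊢
      rw [e] at this
      exact this
    rw [Nat.cast_add]
    have hS : (0 : ℝ) < S := by exact_mod_cast hS
    generalize ((t * v / (S * (k + 1)) + 1 : ℕ) : ℝ) = d at h ⊢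
    rw [add_div, div_self hS.ne']
    calc _ = 1 + (t * v : ℝ) / (S * (k + 1)) / S := by field_simp
      _ ≤ 1 + d / S := by gcongr

lemma hornerDown_le_exp {S : ℕ} (hS : 0 < S) (t k : ℕ) :
    (hornerDown S t k S : ℝ) / S ≤ Real.exp ((t : ℝ) / S) := by
  refine (hornerDown_le hS t k S).trans ?_
  rw [hornerReal_eq, div_self (by positivity), one_mul, ← sum_range_succ]
  exact Real.sum_le_exp_of_nonneg (by positivity) _

lemma exp_le_hornerUp {S : ℕ} (hS : 0 < S) {t k : ℕ} (ht : t ≤ S) (hk : 1 ≤ k) :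
    Real.exp ((t : ℝ) / S) ≤ (hornerUp S t k (2 * S) : ℝ) / S := by
  refine le_trans ?_ (le_hornerUp hS t k (2 * S))
  have h1 : (t : ℝ) / S ≤ 1 := by
    rw [div_le_one (by positivity)]
    exact_mod_cast ht
  have h0 : 0 ≤ (t : ℝ) / S := by positivity
  have h2 : ((2 * S : ℕ) : ℝ) / S = 2 := by
    rw [Nat.cast_mul]; push_cast; field_simp
  rw [hornerReal_eq, h2]
  generalize (t : ℝ) / S = x at h0 h1 ⊢
  refine (Real.exp_bound' h0 h1 hk).trans ?_
  have hk' : (1 : ℝ) ≤ k := by exact_mod_cast hk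
  have h3 : x ^ k * (k + 1) / (k.factorial * k) = (k + 1) / k * (x ^ k / k.factorial) := by
    field_simp
  rw [h3]
  have h4 : ((k : ℝ) + 1) / k ≤ 2 := by rw [div_le_iff₀ (by linarith)]; linarith
  gcongr

lemma squareDown_le {S : ℕ} (hS : 0 < S) {v : ℕ} {x : ℝ} (k : ℕ) (h : (v : ℝ) / S ≤ x) :
    (squareDown S k v : ℝ) / S ≤ x ^ 2 ^ k := by
  induction k generalizing v x with
  | zero => simpa [squareDown] using h
  | succ k ih =>
    rw [squareDown, applyNat_eq, pow_succ', pow_mul]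
    refine ih ?_
    have h1 := Nat.cast_div_le (α := ℝ) (m := v * v) (n := S)
    have hS : (0 : ℝ) < S := by exact_mod_cast hS
    rw [Nat.cast_mul] at h1
    generalize ((v * v / S : ℕ) : ℝ) = d at h1 ⊢
    calc d / S ≤ v * v / S / S := by gcongr
      _ = (v / S) ^ 2 := by field_simp
      _ ≤ x ^ 2 := by gcongr

lemma le_squareUp {S : ℕ} (hS : 0 < S) {v : ℕ} {x : ℝ} (k : ℕ) (hx : 0 ≤ x) (h : x ≤ (v : ℝ) / S) :
    x ^ 2 ^ k ≤ (squareUp S k v : ℝ) / S := by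
  induction k generalizing v x with
  | zero => simpa [squareUp] using h
  | succ k ih =>
    rw [squareUp, applyNat_eq, pow_succ', pow_mul]
    refine ih (by positivity) ?_
    have h1 : (v * v : ℝ) / S ≤ ((v * v / S + 1 : ℕ) : ℝ) := by
      have := (Nat.lt_floor_add_one ((v * v : ℝ) / S)).le
      have e := Nat.floor_div_eq_div (K := ℝ) (v * v) S
      push_cast at e this ⊢
      rw [e] at this
      exact this
    have hS : (0 : ℝ) < S := by exact_mod_cast hS
    generalize ((v * v / S + 1 : ℕ) : ℝ) = d at h1 ⊢
    calc x ^ 2 ≤ ((v : ℝ) / S) ^ 2 := by gcongr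
      _ = (v : ℝ) * v / S / S := by field_simp
      _ ≤ d / S := by gcongr

/-- The numerical verification of the estimate for `n`, where `p` is the partition number,
`a`, `b` bound `π` and `q`, `r` bound `√12` at scale `S`. -/
def numericCheck (S a b q r n p : ℕ) : Bool :=
  applyNat (newtonSqrt ((24 * n - 1) * (S * S)) 18 (110 * S)) fun s ↦
  applyNat (a * (s - 1) / (384 * S)) fun t ↦
  applyNat (b * (s + 1) / (384 * S) + 1) fun u ↦
  applyNat (squareDown S 5 (hornerDown S t 25 S)) fun h ↦
  applyNat (squareUp S 5 (hornerUp S u 25 (2 * S))) fun k ↦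
  Nat.ble ((s - 1) * (s - 1)) ((24 * n - 1) * (S * S)) &&
  (Nat.ble ((24 * n - 1) * (S * S)) ((s + 1) * (s + 1)) &&
  (Nat.ble u S && (Nat.ble S (64 * t) &&
  (Nat.ble (24 * n * (r * k * k * (64 * u - S)))
    (24 * n * (p * (24 * n - 1) * (64 * t) * (S * S * S)) +
      q * h * (24 * n - 1) * (64 * t) * S) &&
  Nat.ble (24 * n * (p * (24 * n - 1) * (64 * u) * (S * S * S)))
    (24 * n * (q * h * h * (64 * t - S)) + q * h * (24 * n - 1) * (64 * t) * S)))))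

lemma abs_sub_le_of_scaled {P A n μ H Q : ℝ} (hA : 0 < A) (hn : 0 < n) (hμ : 0 < μ)
    (h1 : 24 * n * (Q * H ^ 2 * (μ - 1)) ≤ 24 * n * (P * A * μ) + Q * H * A * μ)
    (h2 : 24 * n * (P * A * μ) ≤ 24 * n * (Q * H ^ 2 * (μ - 1)) + Q * H * A * μ) :
    |P - Q / A * (1 - μ⁻¹) * H ^ 2| ≤ Q * H / (24 * n) := by
  have hpos : 0 < 24 * n * (A * μ) := by positivity
  have e : P - Q / A * (1 - μ⁻¹) * H ^ 2 =
      (24 * n * (P * A * μ) - 24 * n * (Q * H ^ 2 * (μ - 1))) / (24 * n * (A * μ)) := by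
    field_simp
  have e2 : Q * H / (24 * n) = Q * H * A * μ / (24 * n * (A * μ)) := by
    field_simp
  rw [e, e2, abs_div, abs_of_pos hpos]
  gcongr
  rw [abs_le]
  constructor <;> linarith

lemma abs_sub_le_of_bounds {P A n μ H Q T U Hd K q r : ℝ} (hA : 0 < A) (hn : 0 < n) (hP : 0 ≤ P)
    (hT : 1 ≤ 64 * T) (hTμ : 64 * T ≤ μ) (hUμ : μ ≤ 64 * U) (hq : 0 ≤ q) (hqQ : q ≤ Q)
    (hQr : Q ≤ r) (hHd : 0 ≤ Hd) (hHdH : Hd ≤ H) (hHK : H ≤ K)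
    (h1 : 24 * n * (r * K ^ 2 * (64 * U - 1)) ≤
      24 * n * (P * A * (64 * T)) + q * Hd * A * (64 * T))
    (h2 : 24 * n * (P * A * (64 * U)) ≤
      24 * n * (q * Hd ^ 2 * (64 * T - 1)) + q * Hd * A * (64 * T)) :
    |P - Q / A * (1 - μ⁻¹) * H ^ 2| ≤ Q * H / (24 * n) := by
  have hμ1 : 0 ≤ μ - 1 := by linarith
  have hT0 : 0 ≤ 64 * T := by linarith
  have hT1 : 0 ≤ 64 * T - 1 := by linarith
  have hr : 0 ≤ r := by linarith
  have hH : 0 ≤ H := by linarith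
  have hQ : 0 ≤ Q := by linarith
  refine abs_sub_le_of_scaled hA hn (by linarith) ?_ ?_
  · refine le_trans ?_ (h1.trans ?_) <;> gcongr
  · refine le_trans ?_ (h2.trans ?_) <;> gcongr

lemma sqrt_twelve_mul_exp_le {n : ℕ} (hn : 1 ≤ n) :
    Real.sqrt 12 * Real.exp (π / 6 * Real.sqrt (24 * n - 1) / 2) / (24 * n) ≤
      Real.exp (π / 2 * Real.sqrt (2 * n / 3)) / (4 * Real.sqrt 3 * n) := by
  have hn' : (1 : ℝ) ≤ n := by exact_mod_cast hn
  have h12 : Real.sqrt 12 = 2 * Real.sqrt 3 := by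
    rw [show (12 : ℝ) = 2 ^ 2 * 3 by norm_num, Real.sqrt_mul (by norm_num),
      Real.sqrt_sq (by norm_num)]
  have h3 : Real.sqrt 3 ^ 2 = 3 := Real.sq_sqrt (by norm_num)
  have h30 : 0 < Real.sqrt 3 := by positivity
  have e : Real.sqrt 12 * Real.exp (π / 6 * Real.sqrt (24 * n - 1) / 2) / (24 * n) =
      Real.exp (π / 6 * Real.sqrt (24 * n - 1) / 2) / (4 * Real.sqrt 3 * n) := by
    rw [h12]
    field_simp
    rw [h3]; norm_num
  rw [e]
  gcongr
  have h4 : Real.sqrt (24 * n - 1) ≤ 6 * Real.sqrt (2 * n / 3) := by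
    rw [Real.sqrt_le_iff]
    refine ⟨by positivity, ?_⟩
    rw [mul_pow, Real.sq_sqrt (by positivity)]
    linarith
  nlinarith [pi_pos]

lemma numericCheck_sound {S a b q r n P : ℕ} (hS : 0 < S) (hn : 1 ≤ n)
    (ha : (a : ℝ) / S ≤ π) (hb : π ≤ (b : ℝ) / S) (hq : (q : ℝ) / S ≤ Real.sqrt 12)
    (hr : Real.sqrt 12 ≤ (r : ℝ) / S) (h : numericCheck S a b q r n P = true) :
    |(P : ℝ) - partitionMain n| ≤
      Real.exp (π / 2 * Real.sqrt (2 * n / 3)) / (4 * Real.sqrt 3 * n) := by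
  simp only [numericCheck, applyNat_eq] at h
  generalize newtonSqrt ((24 * n - 1) * (S * S)) 18 (110 * S) = s at h
  generalize ht : a * (s - 1) / (384 * S) = t at h
  generalize hu : b * (s + 1) / (384 * S) + 1 = u at h
  generalize hh : squareDown S 5 (hornerDown S t 25 S) = H at h
  generalize hk : squareUp S 5 (hornerUp S u 25 (2 * S)) = K at h
  simp only [Bool.and_eq_true, Nat.ble_eq] at h
  obtain ⟨h1, h2, h3, h4, h5, h6⟩ := h
  have hS0 : (0 : ℝ) < S := by exact_mod_cast hS
  have hn' : (1 : ℝ) ≤ n := by exact_mod_cast hn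
  have hA : ((24 * n - 1 : ℕ) : ℝ) = 24 * n - 1 := by
    rw [Nat.cast_sub (by omega)]; push_cast; ring
  have hA0 : (0 : ℝ) < 24 * n - 1 := by linarith
  generalize 24 * n - 1 = A at hA h1 h2 h5 h6
  set y : ℝ := Real.sqrt (24 * n - 1) with hy
  have hy2 : y ^ 2 = A := by rw [hy, Real.sq_sqrt hA0.le, hA]
  have hy0 : 0 ≤ y := Real.sqrt_nonneg _
  have hs1 : ((s - 1 : ℕ) : ℝ) ≤ y * S := by
    refine abs_le_of_sq_le_sq' ?_ (by positivity) |>.2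
    rw [mul_pow, hy2]
    exact_mod_cast (by rwa [sq, sq] : (s - 1) ^ 2 ≤ A * S ^ 2)
  have hs2 : y * S ≤ ((s + 1 : ℕ) : ℝ) := by
    refine abs_le_of_sq_le_sq' ?_ (by positivity) |>.2
    rw [mul_pow, hy2]
    exact_mod_cast (by rwa [sq, sq] : A * S ^ 2 ≤ (s + 1) ^ 2)
  have ha' : (a : ℝ) ≤ π * S := by rwa [div_le_iff₀ hS0] at ha
  have hb' : π * S ≤ (b : ℝ) := by rwa [le_div_iff₀ hS0] at hb
  have hT : (t : ℝ) ≤ π * y / 384 * S := by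
    rw [← ht]
    refine Nat.cast_div_le.trans ?_
    rw [div_le_iff₀ (by positivity)]
    push_cast
    have : (a : ℝ) * (s - 1 : ℕ) ≤ (π * S) * (y * S) := by gcongr
    linarith
  have hU : π * y / 384 * S ≤ u := by
    have h7 : b * (s + 1) ≤ u * (384 * S) := by
      rw [← hu, mul_comm _ (384 * S)]
      exact (Nat.lt_mul_div_succ _ (by positivity)).le
    have h8 : (b : ℝ) * (s + 1 : ℕ) ≤ u * (384 * S) := by exact_mod_cast h7
    have : (π * S) * (y * S) ≤ (b : ℝ) * (s + 1 : ℕ) := by gcongr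
    have h9 : π * y / 384 * S * (384 * S) ≤ u * (384 * S) := by linarith
    exact le_of_mul_le_mul_right h9 (by positivity)
  have hHd : (H : ℝ) / S ≤ Real.exp (π / 6 * y / 2) := by
    rw [← hh]
    refine (squareDown_le hS 5 (hornerDown_le_exp hS t 25)).trans ?_
    rw [← Real.exp_nat_mul]
    apply Real.exp_le_exp.mpr
    have : (t : ℝ) / S ≤ π * y / 384 := by rwa [div_le_iff₀ hS0]
    push_cast
    linarith
  have hK : Real.exp (π / 6 * y / 2) ≤ (K : ℝ) / S := by
    rw [← hk]
    refine le_trans ?_ (le_squareUp hS 5 (Real.exp_pos _).le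
      (exp_le_hornerUp hS h3 (by norm_num : 1 ≤ 25)))
    rw [← Real.exp_nat_mul]
    apply Real.exp_le_exp.mpr
    have : π * y / 384 ≤ (u : ℝ) / S := by rwa [le_div_iff₀ hS0]
    push_cast
    linarith
  have htu : (t : ℝ) ≤ u := hT.trans hU
  have htu' : t ≤ u := by exact_mod_cast htu
  have h4' : (S : ℝ) ≤ 64 * t := by exact_mod_cast h4
  have c1 : ((64 * u - S : ℕ) : ℝ) = 64 * u - S := by
    rw [Nat.cast_sub (by omega)]; push_cast; ring
  have c2 : ((64 * t - S : ℕ) : ℝ) = 64 * t - S := by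
    rw [Nat.cast_sub (by omega)]; push_cast; ring
  have h5' : (24 * n * (r * K * K * (64 * u - S)) : ℝ) ≤
      24 * n * (P * A * (64 * t) * (S * S * S)) + q * H * A * (64 * t) * S := by
    rw [← c1]; exact_mod_cast h5
  have h6' : (24 * n * (P * A * (64 * u) * (S * S * S)) : ℝ) ≤
      24 * n * (q * H * H * (64 * t - S)) + q * H * A * (64 * t) * S := by
    rw [← c2]; exact_mod_cast h6
  have hmain : partitionMain n =
      Real.sqrt 12 / A * (1 - (π / 6 * y)⁻¹) * Real.exp (π / 6 * y / 2) ^ 2 := by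
    rw [partitionMain, ← Real.exp_nat_mul, hA]
    congr 2
    push_cast
    ring
  rw [hmain]
  refine le_trans ?_ (sqrt_twelve_mul_exp_le hn)
  have hS4 : (0 : ℝ) < S ^ 4 := by positivity
  refine abs_sub_le_of_bounds (T := t / S) (U := u / S) (Hd := H / S) (K := K / S) (q := q / S)
    (r := r / S) (by rw [hA]; exact hA0) (by linarith) (by positivity) ?_ ?_ ?_ (by positivity)
    hq hr (by positivity) hHd hK ?_ ?_
  · rw [← mul_div_assoc, le_div_iff₀ hS0]; linarith
  · rw [← mul_div_assoc, div_le_iff₀ hS0]; linarith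
  · rw [← mul_div_assoc, le_div_iff₀ hS0]; linarith
  · refine le_of_mul_le_mul_right ?_ hS4
    refine le_trans (le_of_eq ?_) (h5'.trans (le_of_eq ?_))
    · field_simp
    · field_simp
  · refine le_of_mul_le_mul_right ?_ hS4
    refine le_trans (le_of_eq ?_) (h6'.trans (le_of_eq ?_))
    · field_simp
    · field_simp

/-- The `i`-th digit of `L` in base `2 ^ 80`. -/
def digit (L i : ℕ) : ℕ := L / 2 ^ (80 * i) % 2 ^ 80

/-- The two terms of index `j` in the pentagonal recursion, where the digits of `L` are the
previous partition numbers. -/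
def pentagonalTerm (L j : ℕ) : ℕ :=
  digit L (j * (3 * j - 1) / 2 - 1) + digit L (j * (3 * j + 1) / 2 - 1)

/-- The sum of the terms of odd index. -/
def oddTerms (L : ℕ) : ℕ → ℕ
  | 0 => 0
  | k + 1 => oddTerms L k + pentagonalTerm L (2 * k + 1)

/-- The sum of the terms of even positive index. -/
def evenTerms (L : ℕ) : ℕ → ℕ
  | 0 => 0
  | k + 1 => evenTerms L k + pentagonalTerm L (2 * k + 2)

/-- Verification of `f n (p n)` for `k` consecutive values of `n`, the digits of `L` being the
previous partition numbers. -/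
def partitionScan (f : ℕ → ℕ → Bool) : ℕ → ℕ → ℕ → Bool
  | 0, _, _ => true
  | k + 1, n, L => applyNat (oddTerms L 9 - evenTerms L 9) fun q ↦
      Nat.ble (q + 1) (2 ^ 80) && (f n q &&
        applyNat (n + 1) fun m ↦ applyNat (L * 2 ^ 80 + q) fun M ↦ partitionScan f k m M)

lemma sum_Icc_neg_eq (F : ℤ → ℤ) (m : ℕ) : ∑ k ∈ Icc (-(m : ℤ)) m, F k =
    F 0 + ∑ j ∈ range m, (F (j + 1) + F (-(j + 1))) := by
  induction m with
  | zero => simp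
  | succ m ih =>
    rw [sum_range_succ, ← add_assoc, ← ih]
    have : Icc (-((m + 1 : ℕ) : ℤ)) (m + 1 : ℕ) =
        insert (m + 1 : ℤ) (insert (-(m + 1 : ℤ)) (Icc (-(m : ℤ)) m)) := by
      ext x; simp only [mem_insert, mem_Icc]; push_cast; omega
    rw [this, sum_insert, sum_insert]
    · ring
    · simp
    · simp only [mem_insert, mem_Icc]; omega

lemma sum_range_card_partition {n : ℕ} (hn : 1 ≤ n) : ∑ l ∈ range (n + 1),
    (PowerSeries.pentagonalSeries ℤ).coeff l * (Fintype.card (Nat.Partition (n - l)) : ℤ) = 0 := by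
  have h := congrArg (PowerSeries.coeff n) (partitionSeries_mul_pentagonalSeries ℤ)
  rw [mul_comm, PowerSeries.coeff_mul, Finset.Nat.sum_antidiagonal_eq_sum_range_succ_mk,
    PowerSeries.coeff_one, if_neg (by omega)] at h
  simpa [partitionSeries] using h

lemma sum_pentagonal_card_partition {n : ℕ} (hn : 1 ≤ n) (m : ℕ)
    (hm : n < m * (3 * m + 5) / 2 + 1) :
    (∑ k ∈ Icc (-(m : ℤ)) m, (Int.negOnePow k : ℤ) *
      (if pentagonal k ≤ n then
        (Fintype.card (Nat.Partition (n - pentagonal k)) : ℤ) else 0)) = 0 := by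
  refine Eq.trans (Eq.symm ?_) (sum_range_card_partition hn)
  have h1 : ∀ l ∈ range (n + 1),
      (PowerSeries.pentagonalSeries ℤ).coeff l * (Fintype.card (Nat.Partition (n - l)) : ℤ) =
      (PowerSeries.pentagonalSeries ℤ).coeff l *
        (if l ≤ n then (Fintype.card (Nat.Partition (n - l)) : ℤ) else 0) := by
    intro l hl
    rw [if_pos (by simpa [Nat.lt_succ_iff] using hl)]
  rw [sum_congr rfl h1]
  have h2 : ∀ k ∈ Icc (-(m : ℤ)) m, (Int.negOnePow k : ℤ) *
      (if pentagonal k ≤ n then (Fintype.card (Nat.Partition (n - pentagonal k)) : ℤ) else 0) =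
      (PowerSeries.pentagonalSeries ℤ).coeff (pentagonal k) *
      (if pentagonal k ≤ n then (Fintype.card (Nat.Partition (n - pentagonal k)) : ℤ) else 0) := by
    intro k _
    congr 1
    rw [PowerSeries.coeff_pentagonalSeries_pentagonal, Int.cast_id]
  rw [sum_congr rfl h2, ← sum_image (f := fun l ↦ (PowerSeries.pentagonalSeries ℤ).coeff l *
      (if l ≤ n then (Fintype.card (Nat.Partition (n - l)) : ℤ) else 0))
      (g := pentagonal) (fun _ _ _ _ h ↦ pentagonal_injective h)]
  rw [sum_subset (s₁ := range (n + 1)) (s₂ := range (n + 1) ∪ (Icc (-(m : ℤ)) m).image pentagonal)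
    subset_union_left]
  · symm
    refine sum_subset subset_union_right fun l _ hl ↦ ?_
    by_cases hln : l ≤ n
    · rw [PowerSeries.coeff_pentagonalSeries_eq_zero, zero_mul]
      rintro ⟨k, rfl⟩
      refine hl (mem_image_of_mem _ ?_)
      by_contra hk
      have h3 := two_mul_natCast_pentagonal k
      have h4 : 2 * pentagonal k ≤ m * (3 * m + 5) + 1 := by omega
      have h5 : 2 * (pentagonal k : ℤ) ≤ m * (3 * m + 5) + 1 := by exact_mod_cast h4
      have h6 : (m : ℤ) + 1 ≤ k ∨ k ≤ -(m + 1 : ℤ) := by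
        simp only [mem_Icc, not_and_or] at hk; omega
      rcases h6 with h6 | h6 <;> nlinarith
    · rw [if_neg hln, mul_zero]
  · intro l _ hl
    rw [if_neg (by simpa [Nat.lt_succ_iff] using hl), mul_zero]

lemma digit_mul_add {L q : ℕ} (hq : q < 2 ^ 80) (i : ℕ) :
    digit (L * 2 ^ 80 + q) i = if i = 0 then q else digit L (i - 1) := by
  have key : ∀ B : ℕ, q < B → (L * B + q) / B ^ i % B =
      if i = 0 then q else L / B ^ (i - 1) % B := by
    intro B hB
    rcases i with _ | i
    · simp [Nat.mod_eq_of_lt hB]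
    · rw [if_neg (by omega), pow_succ', ← Nat.div_div_eq_div_mul, mul_comm L,
        Nat.mul_add_div (by omega), Nat.div_eq_of_lt hB, add_zero, Nat.add_sub_cancel]
  simpa only [digit, pow_mul] using key (2 ^ 80) hq

lemma pentagonalTerm_eq {n L : ℕ}
    (hL : ∀ i, digit L i = if i < n then Fintype.card (Nat.Partition (n - 1 - i)) else 0) (j : ℕ) :
    (pentagonalTerm L (j + 1) : ℤ) =
      (if pentagonal (j + 1) ≤ n then
        (Fintype.card (Nat.Partition (n - pentagonal (j + 1))) : ℤ) else 0) +
      (if pentagonal (-(j + 1)) ≤ n then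
        (Fintype.card (Nat.Partition (n - pentagonal (-(j + 1)))) : ℤ) else 0) := by
  have h1 : pentagonal (j + 1) = (j + 1) * (3 * (j + 1) - 1) / 2 := by
    have := natCast_pentagonal (j + 1)
    zify
    rw [this]
    push_cast [Nat.cast_sub (show 1 ≤ 3 * (j + 1) by omega)]
    rfl
  have h2 : pentagonal (-(j + 1)) = (j + 1) * (3 * (j + 1) + 1) / 2 := by
    rw [pentagonal_neg]
    zify
    rw [Int.toNat_of_nonneg (by positivity)]
  have h3 : 1 ≤ pentagonal (j + 1) := by
    rw [h1, Nat.le_div_iff_mul_le (by norm_num)]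
    have : 2 ≤ 3 * (j + 1) - 1 := by omega
    nlinarith
  have h4 : 1 ≤ pentagonal (-(j + 1)) := by
    rw [h2, Nat.le_div_iff_mul_le (by norm_num)]
    nlinarith
  have h5 : ∀ l, 1 ≤ l → (digit L (l - 1) : ℤ) =
      if l ≤ n then (Fintype.card (Nat.Partition (n - l)) : ℤ) else 0 := by
    intro l hl
    rw [hL]
    by_cases h : l ≤ n
    · rw [if_pos h, if_pos (by omega), show n - 1 - (l - 1) = n - l by omega]
    · rw [if_neg h, if_neg (by omega)]; rfl
  rw [pentagonalTerm, ← h1, ← h2, Nat.cast_add, h5 _ h3, h5 _ h4]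

lemma oddTerms_sub_evenTerms {n L : ℕ} (hn : 1 ≤ n) (hn' : n < 500)
    (hL : ∀ i, digit L i = if i < n then Fintype.card (Nat.Partition (n - 1 - i)) else 0) :
    oddTerms L 9 - evenTerms L 9 = Fintype.card (Nat.Partition n) := by
  have h := sum_pentagonal_card_partition hn 18 (by omega)
  rw [sum_Icc_neg_eq] at h
  have h1 : ∀ j ∈ range 18, ((Int.negOnePow (j + 1) : ℤ) * (if pentagonal (j + 1) ≤ n then
        (Fintype.card (Nat.Partition (n - pentagonal (j + 1))) : ℤ) else 0) +
      (Int.negOnePow (-(j + 1)) : ℤ) * (if pentagonal (-(j + 1)) ≤ n then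
        (Fintype.card (Nat.Partition (n - pentagonal (-(j + 1)))) : ℤ) else 0)) =
      (-1) ^ (j + 1) * (pentagonalTerm L (j + 1) : ℤ) := by
    intro j _
    rw [pentagonalTerm_eq hL, Int.negOnePow_neg, ← mul_add]
    rw [show (j : ℤ) + 1 = (j + 1 : ℕ) by push_cast; rfl, Int.coe_negOnePow_natCast]
  rw [sum_congr rfl h1] at h
  have h0 : pentagonal 0 = 0 := by simp [pentagonal_def]
  simp only [sum_range_succ, sum_range_zero, h0] at h
  simp only [oddTerms, evenTerms, Nat.reduceMul, Nat.reduceAdd]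
  simp at h
  omega

lemma partitionScan_sound {f : ℕ → ℕ → Bool} (k : ℕ) {n L : ℕ} (hn : 1 ≤ n) (hk : n + k ≤ 500)
    (hL : ∀ i, digit L i = if i < n then Fintype.card (Nat.Partition (n - 1 - i)) else 0)
    (h : partitionScan f k n L = true) {m : ℕ} (hm : n ≤ m) (hm' : m < n + k) :
    f m (Fintype.card (Nat.Partition m)) = true := by
  induction k generalizing n L with
  | zero => omega
  | succ k ih =>
    simp only [partitionScan, applyNat_eq, Bool.and_eq_true, Nat.ble_eq] at h
    obtain ⟨h1, h2, h3⟩ := h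
    rw [oddTerms_sub_evenTerms hn (by omega) hL] at h1 h2 h3
    rcases hm.eq_or_lt with rfl | hlt
    · exact h2
    · refine ih (by omega) (by omega) ?_ h3 hlt (by omega)
      intro i
      rw [digit_mul_add (by omega), hL]
      rcases i with _ | i
      · simp
      · simp [show n - (i + 1) = n - 1 - i by omega]

lemma partitionScan_numericCheck : partitionScan (numericCheck 1000000000000000000000000000000000000
    3141592653589793238460000000000000000 3141592653589793238470000000000000000
    3464101615137754587050000000000000000 3464101615137754587060000000000000000)
    499 1 1 = true := by
  decide +kernel

lemma partition_approx_of_scan {S a b q r : ℕ} (hS : 0 < S) (ha : (a : ℝ) / S ≤ π)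
    (hb : π ≤ (b : ℝ) / S) (hq : (q : ℝ) / S ≤ Real.sqrt 12) (hr : Real.sqrt 12 ≤ (r : ℝ) / S)
    (h : partitionScan (numericCheck S a b q r) 499 1 1 = true) {n : ℕ} (hn : 1 ≤ n)
    (hn' : n < 500) :
    |(Fintype.card (Nat.Partition n) : ℝ) - partitionMain n| ≤
      Real.exp (π / 2 * Real.sqrt (2 * n / 3)) / (4 * Real.sqrt 3 * n) := by
  refine numericCheck_sound hS hn ha hb hq hr
    (partitionScan_sound 499 le_rfl le_rfl (fun i ↦ ?_) h hn hn')
  rcases i with _ | i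
  · simp [digit]
  · have : 1 < 2 ^ (80 * (i + 1)) := Nat.one_lt_two_pow (by omega)
    rw [digit, Nat.div_eq_of_lt this, if_neg (by omega), Nat.zero_mod]

lemma partition_approx_of_small {n : ℕ} (hn : 1 ≤ n) (hn' : n < 500) :
    |(Fintype.card (Nat.Partition n) : ℝ) - partitionMain n| ≤
      Real.exp (π / 2 * Real.sqrt (2 * n / 3)) / (4 * Real.sqrt 3 * n) := by
  refine partition_approx_of_scan ?_ ?_ ?_ ?_ ?_ partitionScan_numericCheck hn hn'
  · norm_num
  · refine le_trans (le_of_eq ?_) Real.pi_gt_d20.le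
    norm_num
  · refine Real.pi_lt_d20.le.trans (le_of_eq ?_)
    norm_num
  · apply Real.le_sqrt_of_sq_le
    norm_num
  · rw [Real.sqrt_le_iff]
    norm_num

lemma partition_approx {n : ℕ} (hn : 1 ≤ n) :
    |(Fintype.card (Nat.Partition n) : ℝ) - partitionMain n| ≤
      Real.exp (π / 2 * Real.sqrt (2 * n / 3)) / (4 * Real.sqrt 3 * n) := by
  rcases lt_or_ge n 500 with h | h
  · exact partition_approx_of_small hn h
  · exact partition_approx_of_large h

lemma c_div_rpow_eq {n : ℕ} (m : ℕ) : c m / (n : ℝ) ^ ((m : ℝ) / 2) =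
    (-1) ^ m * ((1 / Real.sqrt (24 * n) / 2) ^ m * innerSum (π / 6) m) := by
  have h1 : (n : ℝ) ^ ((m : ℝ) / 2) = Real.sqrt n ^ m := by
    rw [Real.sqrt_eq_rpow, ← Real.rpow_natCast, ← Real.rpow_mul (by positivity)]
    congr 1
    ring
  have h2 : Real.sqrt (24 * n) = 2 * Real.sqrt 6 * Real.sqrt n := by
    rw [show (24 : ℝ) = 2 ^ 2 * 6 by norm_num, Real.sqrt_mul (by norm_num),
      Real.sqrt_mul (by norm_num), Real.sqrt_sq (by norm_num)]
  have h3 : c m = (-1) ^ m / (4 * Real.sqrt 6) ^ m * innerSum (π / 6) m := rfl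
  have h4 : 1 / (2 * Real.sqrt 6 * Real.sqrt n) / 2 =
      (4 * Real.sqrt 6)⁻¹ * (Real.sqrt n)⁻¹ := by
    rw [← mul_inv, div_div, one_div]
    ring_nf
  rw [h1, h2, h3, h4, mul_pow _ (Real.sqrt n)⁻¹, inv_pow, inv_pow]
  ring

lemma normalized_partitionMain {n : ℕ} (hn : 1 ≤ n) :
    4 * Real.sqrt 3 * n * Real.exp (-(π * Real.sqrt (2 * n / 3))) * partitionMain n =
      1 / Real.sqrt (1 - (1 / Real.sqrt (24 * n)) ^ 2) ^ 2 *
        (1 - 1 / Real.sqrt (24 * n) / (π / 6 * Real.sqrt (1 - (1 / Real.sqrt (24 * n)) ^ 2))) *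
        Real.exp (-(π / 6 / (1 / Real.sqrt (24 * n)) *
          (1 - Real.sqrt (1 - (1 / Real.sqrt (24 * n)) ^ 2)))) := by
  have hn' : (1 : ℝ) ≤ n := by exact_mod_cast hn
  have hr2 : Real.sqrt (24 * n) ^ 2 = 24 * n := Real.sq_sqrt (by positivity)
  have hr0 : 0 < Real.sqrt (24 * n) := by positivity
  have hs2 : Real.sqrt (24 * n - 1) ^ 2 = 24 * n - 1 := Real.sq_sqrt (by linarith)
  have hs0 : 0 < Real.sqrt (24 * n - 1) := Real.sqrt_pos.mpr (by linarith)
  have hD : Real.sqrt (1 - (1 / Real.sqrt (24 * n)) ^ 2) =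
      Real.sqrt (24 * n - 1) / Real.sqrt (24 * n) := by
    rw [← Real.sqrt_div (by linarith), div_pow, hr2]
    congr 1
    field_simp
  have h6 : Real.sqrt (2 * n / 3) = Real.sqrt (24 * n) / 6 := by
    rw [Real.sqrt_eq_iff_mul_self_eq (by positivity) (by positivity)]
    nlinarith
  have h12 : Real.sqrt 12 = 2 * Real.sqrt 3 := by
    rw [show (12 : ℝ) = 2 ^ 2 * 3 by norm_num, Real.sqrt_mul (by norm_num),
      Real.sqrt_sq (by norm_num)]
  have h3 : Real.sqrt 3 ^ 2 = 3 := Real.sq_sqrt (by norm_num)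
  rw [hD, h6, partitionMain, h12]
  generalize Real.sqrt (24 * n) = r at *
  generalize Real.sqrt (24 * n - 1) = s at *
  have hexp : Real.exp (-(π / 6 / (1 / r) * (1 - s / r))) =
      Real.exp (-(π * (r / 6))) * Real.exp (π / 6 * s) := by
    rw [← Real.exp_add]
    congr 1
    field_simp
    ring
  have hpi := pi_pos
  rw [hexp, ← hs2]
  have e1 : 1 / r / (π / 6 * (s / r)) = (π / 6 * s)⁻¹ := by field_simp
  have e2 : 1 / (s / r) ^ 2 = 24 * n / s ^ 2 := by rw [div_pow, hr2, one_div_div]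
  rw [e1, e2]
  calc _ = 8 * Real.sqrt 3 ^ 2 * n / s ^ 2 * (1 - (π / 6 * s)⁻¹) *
        (Real.exp (-(π * (r / 6))) * Real.exp (π / 6 * s)) := by ring
    _ = _ := by rw [h3]; ring

lemma normalized_partition_error {n : ℕ} (hn : 1 ≤ n) :
    |4 * Real.sqrt 3 * n * Real.exp (-(π * Real.sqrt (2 * n / 3))) * (p n - partitionMain n)| ≤
      Real.exp (-(π / 2 * Real.sqrt (2 * n / 3))) := by
  have hn' : (1 : ℝ) ≤ n := by exact_mod_cast hn
  have h := partition_approx hn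
  rw [abs_mul, abs_of_pos (by positivity)]
  calc _ ≤ 4 * Real.sqrt 3 * n * Real.exp (-(π * Real.sqrt (2 * n / 3))) *
        (Real.exp (π / 2 * Real.sqrt (2 * n / 3)) / (4 * Real.sqrt 3 * n)) := by
        gcongr; exact h
    _ = Real.exp (-(π * Real.sqrt (2 * n / 3))) * Real.exp (π / 2 * Real.sqrt (2 * n / 3)) := by
        have : 0 < Real.sqrt 3 := by positivity
        field_simp
    _ = _ := by
        rw [← Real.exp_add]; congr 1; ring

lemma alternating_tail_bounds {f : ℕ → ℝ} {l : ℝ} (hf : StrictAnti f)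
    (hl : HasSum (fun m ↦ (-1) ^ m * f m) l) (N : ℕ) :
    0 < l - ∑ m ∈ range (2 * N), (-1) ^ m * f m ∧
      l - ∑ m ∈ range (2 * N), (-1) ^ m * f m < f (2 * N) := by
  have h1 := hf.antitone.alternating_series_le_tendsto hl.tendsto_sum_nat (N + 1)
  have h2 := hf.antitone.tendsto_le_alternating_series hl.tendsto_sum_nat (N + 1)
  have e : 2 * (N + 1) = 2 * N + 1 + 1 := by ring
  have e0 : (-1 : ℝ) ^ (2 * N) = 1 := by rw [pow_mul, neg_one_sq, one_pow]
  have e1 : (-1 : ℝ) ^ (2 * N + 1) = -1 := by rw [pow_succ, e0, one_mul]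
  have e2 : (-1 : ℝ) ^ (2 * N + 1 + 1) = 1 := by rw [pow_succ, e1]; norm_num
  rw [e] at h1 h2
  simp only [sum_range_succ, e0, e1, e2] at h1 h2
  have h3 := hf (show 2 * N < 2 * N + 1 by omega)
  have h4 := hf (show 2 * N + 1 < 2 * N + 1 + 1 by omega)
  constructor <;> linarith

theorem stmt13 (C : ℝ) (hC : 0 < C) (N n : ℕ) (hN : 1 ≤ N) (hn : 1 ≤ n)
    (h : Real.exp (-(π / 2 * Real.sqrt (2 * n / 3))) ≤
      C * Real.sqrt (2 * N + 1) / Real.sqrt (24 * n) ^ (2 * N)) :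
    -(C * Real.sqrt (2 * N + 1) / Real.sqrt (24 * n) ^ (2 * N)) < R (2 * N) n ∧
      R (2 * N) n <
        (C + 6 * Real.sqrt 2 / π ^ ((3 : ℝ) / 2) * Real.sinh (π / 6) *
            Real.sqrt (1 + 1 / (4 * N + 1))) *
          Real.sqrt (2 * N + 1) / Real.sqrt (24 * n) ^ (2 * N) := by
  have hn' : (1 : ℝ) ≤ n := by exact_mod_cast hn
  have hpi1 := Real.pi_gt_d2
  have hpi2 := Real.pi_lt_d2
  have ha : 0 < π / 6 := by linarith
  have hr0 : 0 < Real.sqrt (24 * n) := by positivity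
  have hr4 : 4 < Real.sqrt (24 * n) := Real.lt_sqrt_of_sq_lt (by linarith)
  have herr := (normalized_partition_error hn).trans h
  have hmain := normalized_partitionMain hn
  have hsum := hasSum_innerSum (x := 1 / Real.sqrt (24 * n)) ha (by positivity)
    (by rw [div_lt_one hr0]; linarith) rfl
  rw [← hmain] at hsum
  have hanti : StrictAnti
      fun m ↦ (1 / Real.sqrt (24 * n) / 2) ^ m * innerSum (π / 6) m := by
    refine strictAnti_nat_of_succ_lt fun m ↦ ?_
    have h1 := innerSum_succ_le (a := π / 6) (by linarith) (by linarith) m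
    have h2 := innerSum_pos ha m
    have hx : 1 / Real.sqrt (24 * n) / 2 < 1 / 6.2 := by
      rw [div_div]
      apply one_div_lt_one_div_of_lt <;> linarith
    have hx0 : 0 < 1 / Real.sqrt (24 * n) / 2 := by positivity
    generalize 1 / Real.sqrt (24 * n) / 2 = z at *
    rw [pow_succ, mul_assoc]
    refine mul_lt_mul_of_pos_left ?_ (by positivity)
    calc z * innerSum (π / 6) (m + 1) ≤ z * (6.2 * innerSum (π / 6) m) := by gcongr
      _ < 1 / 6.2 * (6.2 * innerSum (π / 6) m) := by gcongr
      _ = _ := by ring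
  obtain ⟨ht1, ht2⟩ := alternating_tail_bounds hanti hsum N
  have hR : R (2 * N) n =
      4 * Real.sqrt 3 * n * Real.exp (-(π * Real.sqrt (2 * n / 3))) * (p n - partitionMain n) +
      (4 * Real.sqrt 3 * n * Real.exp (-(π * Real.sqrt (2 * n / 3))) * partitionMain n -
        ∑ m ∈ range (2 * N),
          (-1) ^ m * ((1 / Real.sqrt (24 * n) / 2) ^ m * innerSum (π / 6) m)) := by
    rw [R, sum_congr rfl fun m _ ↦ c_div_rpow_eq m]
    ring
  have hf : (1 / Real.sqrt (24 * n) / 2) ^ (2 * N) * innerSum (π / 6) (2 * N) ≤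
      6 * Real.sqrt 2 / π ^ ((3 : ℝ) / 2) * Real.sinh (π / 6) *
        Real.sqrt (1 + 1 / (4 * N + 1)) * Real.sqrt (2 * N + 1) / Real.sqrt (24 * n) ^ (2 * N) := by
    rw [le_div_iff₀ (by positivity)]
    refine le_trans (le_of_eq ?_) (half_pow_mul_innerSum_le N)
    rw [div_div, one_div, one_div, mul_inv, mul_pow, inv_pow]
    field_simp
  obtain ⟨he1, he2⟩ := abs_le.mp herr
  rw [hR, add_mul, add_div]
  constructor <;> linarith
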